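/- There exist a natural number k and computable sequences n ↦ R_n and n ↦ S_n of finite sets of words in the free group on k generators (words encoded as lists of pairs (generator, exponent sign)), with the cardinalities of R_n and of S_n constant in n, such that: (1) for every n, the group Γ_n presented by ⟨x₁,…,x_k ∣ R_n⟩ is residually finite; (2) for every n, the subgroup P_n of Γ_n generated by the images of the words in S_n is a finitely presentable group; and (3) there is no computable function f : ℕ → Bool such that f(n) = true if and only if the inclusion P_n ↪ Γ_n induces an isomorphism of profinite completions, i.e. if and only if both (a) every homomorphism from Γ_n onto a finite group remains surjective when restricted to P_n, and (b) for every finite-index normal subgroup M of P_n there exists a finite-index normal subgroup L of Γ_n with L ∩ P_n ≤ M. -/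

import Mathlib

/-- A group `Q` has no nontrivial finite quotients: every homomorphism from `Q`
to a finite group is trivial. -/
def NoNontrivialFiniteQuotients (Q : Type*) [Group Q] : Prop :=
  ∀ (H : Type) [Group H] [Finite H] (f : Q →* H) (q : Q), f q = 1

/-- The map of profinite completions induced by the inclusion of the subgroup `P` of `Γ`
is surjective: every homomorphism from `Γ` onto a finite group remains surjective when
restricted to `P`. -/
def ProfiniteSurj {Γ : Type*} [Group Γ] (P : Subgroup Γ) : Prop :=
  ∀ (H : Type) [Group H] [Finite H] (f : Γ →* H),
    Function.Surjective f → Function.Surjective (f.comp P.subtype)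

/-- The map of profinite completions induced by the inclusion of the subgroup `P` of `Γ`
is injective: for every finite-index normal subgroup `M` of `P` there is a finite-index
normal subgroup `L` of `Γ` with `L ∩ P ≤ M`. -/
def ProfiniteInj {Γ : Type*} [Group Γ] (P : Subgroup Γ) : Prop :=
  ∀ M : Subgroup ↥P, M.Normal → M.FiniteIndex →
    ∃ L : Subgroup Γ, L.Normal ∧ L.FiniteIndex ∧ L.subgroupOf P ≤ M

/-- The second group homology `H₂(Q;ℤ)` with trivial ℤ-coefficients, realized via Hopf's
formula `H₂(Q;ℤ) ≅ (R ∩ [F,F])/[F,R]` for the free presentation `1 → R → F → Q → 1`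
with `F` the free group on the underlying set of `Q`. -/
def H2 (Q : Type*) [Group Q] : Type _ :=
  ↥((FreeGroup.lift (id : Q → Q)).ker ⊓ commutator (FreeGroup Q)) ⧸
    ((⁅(⊤ : Subgroup (FreeGroup Q)), (FreeGroup.lift (id : Q → Q)).ker⁆).subgroupOf
      ((FreeGroup.lift (id : Q → Q)).ker ⊓ commutator (FreeGroup Q)))

/-- A group is finitely presented if it admits a presentation with finitely many
generators and finitely many relators. -/
def FinitelyPresentedGroup (Q : Type*) [Group Q] : Prop :=
  ∃ (k : ℕ) (R : Finset (FreeGroup (Fin k))),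
    Nonempty (PresentedGroup (↑R : Set (FreeGroup (Fin k))) ≃* Q)

/-- A group `G` is residually finite if every nontrivial element is detected by a
homomorphism to a finite group. -/
def ResiduallyFinite (G : Type*) [Group G] : Prop :=
  ∀ g : G, g ≠ 1 → ∃ (H : Type) (_ : Group H) (_ : Finite H) (f : G →* H), f g ≠ 1

/-- The fibre product `P = {(g,g') : p g = p g'}` of a homomorphism `p : G →* Q`,
as a subgroup of `G × G`. -/
def fiberProduct {G Q : Type*} [Group G] [Group Q] (p : G →* Q) : Subgroup (G × G) where
  carrier := {x | p x.1 = p x.2}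
  one_mem' := rfl
  mul_mem' := by
    intro a b ha hb
    simp only [Set.mem_setOf_eq, Prod.fst_mul, Prod.snd_mul, map_mul] at *
    rw [ha, hb]
  inv_mem' := by
    intro a ha
    simp only [Set.mem_setOf_eq, Prod.fst_inv, Prod.snd_inv, map_inv] at *
    rw [ha]

/-- The group presented by generators `x₁,…,x_k` and the relators given by the words in
the list `L` (words are encoded as lists of pairs (generator, exponent sign)). -/
abbrev wordPresentedGroup (k : ℕ) (L : List (List (Fin k × Bool))) :=
  PresentedGroup (FreeGroup.mk '' {w | w ∈ L})

/-- The subgroup of the group presented by `⟨x₁,…,x_k ∣ R⟩` generated by the images of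
the words in the list `S`. -/
abbrev wordSubgroup (k : ℕ) (R S : List (List (Fin k × Bool))) :
    Subgroup (wordPresentedGroup k R) :=
  Subgroup.closure
    ((fun w => PresentedGroup.mk (FreeGroup.mk '' {w | w ∈ R}) (FreeGroup.mk w)) ''
      {v | v ∈ S})

/-- Every partial bijection of `Ω`, given by its graph, extends to a permutation of `Ω ⊕ Ω` that
commutes with each permutation of `Ω` preserving the graph. -/
theorem exists_perm_sum_extending {Ω : Type*} (r : Ω → Ω → Prop)
    (hf : ∀ x y y', r x y → r x y' → y = y') (hi : ∀ x x' y, r x y → r x' y → x = x') :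
    ∃ σ : Equiv.Perm (Ω ⊕ Ω), (∀ x y, r x y → σ (Sum.inl x) = Sum.inl y) ∧
      ∀ π : Equiv.Perm Ω, (∀ x y, r (π x) (π y) ↔ r x y) →
        Commute (Equiv.Perm.sumCongr π π) σ := by
  classical
  let ext (r : Ω → Ω → Prop) : Ω ⊕ Ω → Ω ⊕ Ω := Sum.elim
    (fun x => if h : ∃ y, r x y then Sum.inl h.choose else Sum.inr x)
    (fun y => if h : ∃ x, r x y then Sum.inr h.choose else Sum.inl y)
  have ext_inl {r : Ω → Ω → Prop} (hf : ∀ x y y', r x y → r x y' → y = y') {x y} (h : r x y) :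
      ext r (Sum.inl x) = Sum.inl y := by
    have h' : ∃ y, r x y := ⟨y, h⟩
    simp only [ext, Sum.elim_inl, dif_pos h']
    rw [hf _ _ _ h'.choose_spec h]
  have ext_inr {r : Ω → Ω → Prop} (hi : ∀ x x' y, r x y → r x' y → x = x') {x y} (h : r x y) :
      ext r (Sum.inr y) = Sum.inr x := by
    have h' : ∃ x, r x y := ⟨x, h⟩
    simp only [ext, Sum.elim_inr, dif_pos h']
    rw [hi _ _ _ h'.choose_spec h]
  have ext_inl_none {r : Ω → Ω → Prop} {x} (h : ¬ ∃ y, r x y) :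
      ext r (Sum.inl x) = Sum.inr x := by simp only [ext, Sum.elim_inl, dif_neg h]
  have ext_inr_none {r : Ω → Ω → Prop} {y} (h : ¬ ∃ x, r x y) :
      ext r (Sum.inr y) = Sum.inl y := by simp only [ext, Sum.elim_inr, dif_neg h]
  have inv {r : Ω → Ω → Prop} (hf : ∀ x y y', r x y → r x y' → y = y')
      (hi : ∀ x x' y, r x y → r x' y → x = x') (z) :
      ext (fun x y => r y x) (ext r z) = z := by
    rcases z with x | y
    · by_cases h : ∃ y, r x y
      · obtain ⟨y, h⟩ := h
        rw [ext_inl hf h]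
        exact ext_inl (r := fun x y => r y x) (fun _ _ _ h h' => hi _ _ _ h h') h
      · rw [ext_inl_none h]
        exact ext_inr_none (r := fun x y => r y x) h
    · by_cases h : ∃ x, r x y
      · obtain ⟨x, h⟩ := h
        rw [ext_inr hi h]
        exact ext_inr (r := fun x y => r y x) (fun _ _ _ h h' => hf _ _ _ h h') h
      · rw [ext_inr_none h]
        exact ext_inl_none (r := fun x y => r y x) h
  refine ⟨⟨ext r, ext fun x y => r y x, inv hf hi,
    inv (r := fun x y => r y x) (fun _ _ _ h h' => hi _ _ _ h h')
      (fun _ _ _ h h' => hf _ _ _ h h')⟩, fun x y h => ext_inl hf h, fun π hπ => ?_⟩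
  have hπ' (x y) : r x y ↔ r (π.symm x) (π.symm y) := by
    rw [← hπ (π.symm x) (π.symm y)]; simp
  ext z : 1
  change (Equiv.Perm.sumCongr π π) (ext r z) = ext r ((Equiv.Perm.sumCongr π π) z)
  rcases z with x | y
  · by_cases h : ∃ y, r x y
    · obtain ⟨y, h⟩ := h
      rw [ext_inl hf h]
      exact (ext_inl hf ((hπ x y).2 h)).symm
    · rw [ext_inl_none h]
      refine (ext_inl_none ?_).symm
      rintro ⟨y, hy⟩
      refine h ⟨π.symm y, ?_⟩
      rw [hπ'] at hy
      simpa using hy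
  · by_cases h : ∃ x, r x y
    · obtain ⟨x, h⟩ := h
      rw [ext_inr hi h]
      exact (ext_inr hi ((hπ x y).2 h)).symm
    · rw [ext_inr_none h]
      refine (ext_inr_none ?_).symm
      rintro ⟨x, hx⟩
      refine h ⟨π.symm x, ?_⟩
      rw [hπ'] at hx
      simpa using hx

/-- An element of the subgroup generated by a subgroup `H` and an element `t` is a product
`h * t ^ u₁ * h₁ * ⋯ * t ^ uₙ * hₙ` without the pinches given by `A`. -/
theorem exists_reduced_expression {Γ : Type*} [Group Γ] (t : Γ) (H : Subgroup Γ)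
    (A : ℤˣ → Set Γ)
    (hA : ∀ u, ∀ a ∈ H, a ∈ A u → t ^ (u : ℤ) * a * (t ^ (u : ℤ))⁻¹ ∈ H)
    {g : Γ} (hg : g ∈ Subgroup.closure ((H : Set Γ) ∪ {t})) :
    ∃ h ∈ H, ∃ L : List (ℤˣ × Γ), (∀ p ∈ L, p.2 ∈ H) ∧
      L.IsChain (fun a b => a.2 ∈ A a.1 → a.1 = b.1) ∧
      g = h * (L.map fun p => t ^ (p.1 : ℤ) * p.2).prod := by
  have step (u : ℤˣ) {g : Γ} (hg : ∃ h ∈ H, ∃ L : List (ℤˣ × Γ), (∀ p ∈ L, p.2 ∈ H) ∧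
      L.IsChain (fun a b => a.2 ∈ A a.1 → a.1 = b.1) ∧
      g = h * (L.map fun p => t ^ (p.1 : ℤ) * p.2).prod) :
      ∃ h ∈ H, ∃ L : List (ℤˣ × Γ), (∀ p ∈ L, p.2 ∈ H) ∧
      L.IsChain (fun a b => a.2 ∈ A a.1 → a.1 = b.1) ∧
      t ^ (u : ℤ) * g = h * (L.map fun p => t ^ (p.1 : ℤ) * p.2).prod := by
    obtain ⟨h, hh, L, hL, hc, rfl⟩ := hg
    rcases L with _ | ⟨⟨u', h'⟩, L⟩
    · exact ⟨1, H.one_mem, [(u, h)], by simpa using hh, by simp, by simp⟩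
    · by_cases hp : h ∈ A u ∧ u ≠ u'
      · have hu : u' = -u := by
          rcases Int.units_eq_one_or u with rfl | rfl <;>
          rcases Int.units_eq_one_or u' with rfl | rfl <;> simp_all
        subst hu
        refine ⟨t ^ (u : ℤ) * h * (t ^ (u : ℤ))⁻¹ * h',
          H.mul_mem (hA u h hh hp.1) (hL _ List.mem_cons_self), L,
          fun p hp => hL p (List.mem_cons_of_mem _ hp), hc.tail, ?_⟩
        simp [mul_assoc]
      · refine ⟨1, H.one_mem, (u, h) :: (u', h') :: L, ?_, ?_, by simp [mul_assoc]⟩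
        · intro p hp
          rcases List.mem_cons.1 hp with rfl | hp
          exacts [hh, hL p hp]
        · refine List.isChain_cons_cons.2 ⟨?_, hc⟩
          intro h1
          by_contra h2
          exact hp ⟨h1, h2⟩
  induction hg using Subgroup.closure_induction_left with
  | one => exact ⟨1, H.one_mem, [], by simp, by simp, by simp⟩
  | mul_left x hx y _ ih =>
    rcases hx with hx | rfl
    · obtain ⟨h, hh, L, hL, hc, rfl⟩ := ih
      exact ⟨x * h, H.mul_mem hx hh, L, hL, hc, by rw [mul_assoc]⟩
    · simpa using step 1 ih
  | inv_mul_cancel x hx y _ ih =>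
    rcases hx with hx | rfl
    · obtain ⟨h, hh, L, hL, hc, rfl⟩ := ih
      exact ⟨x⁻¹ * h, H.mul_mem (H.inv_mem hx) hh, L, hL, hc, by rw [mul_assoc]⟩
    · simpa using step (-1) ih

/-- The group `Γ` with generators `x` is presented by the commutation relations between adjacent
vertices of `E`, i.e. it is the right-angled Artin group of `E`. -/
structure IsRaag {V Γ : Type} [Group Γ] (E : V → V → Prop) (x : V → Γ) : Prop where
  closure_range : Subgroup.closure (Set.range x) = ⊤
  commute : ∀ u v, E u v → Commute (x u) (x v)
  exists_lift : ∀ (K : Type) [Group K] (f : V → K),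
    (∀ u v, E u v → Commute (f u) (f v)) → ∃ φ : Γ →* K, ∀ v, φ (x v) = f v

/-- The permutations of `(K × ι) ⊕ (K × ι)` given by left multiplication on both copies of `K`. -/
def leftMulSumHom (K ι : Type*) [Group K] : K →* Equiv.Perm ((K × ι) ⊕ (K × ι)) where
  toFun k := Equiv.Perm.sumCongr ((Equiv.mulLeft k).prodCongr (Equiv.refl ι))
    ((Equiv.mulLeft k).prodCongr (Equiv.refl ι))
  map_one' := by ext z : 1; rcases z with z | z <;> simp
  map_mul' a b := by ext z : 1; rcases z with z | z <;> simp [mul_assoc, Prod.map]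

theorem leftMulSumHom_inl {K ι : Type*} [Group K] (k a : K) (i : ι) :
    leftMulSumHom K ι k (Sum.inl (a, i)) = Sum.inl (k * a, i) := rfl

/-- A word whose syllables avoid the diagonal at each change of sign acts nontrivially on a
finite set. -/
theorem exists_perm_path {K : Type} [Group K] (Δ : Subgroup K) (L : List (ℤˣ × K))
    (hL : L.IsChain fun a b => a.2 ∈ Δ → a.1 = b.1) :
    ∃ σ : Equiv.Perm ((K × Fin (L.length + 1)) ⊕ (K × Fin (L.length + 1))),
      (∀ δ ∈ Δ, Commute (leftMulSumHom K (Fin (L.length + 1)) δ) σ) ∧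
      ((L.map fun p => σ ^ (p.1 : ℤ) * leftMulSumHom K (Fin (L.length + 1)) p.2).prod
        (Sum.inl (1, Fin.last _)) = Sum.inl (1, 0)) := by
  let r (s : ℤˣ) (x y : K × Fin (L.length + 1)) : Prop := ∃ (i : Fin L.length) (δ : Δ),
    (L[i].1 = s ∧ x = ((δ : K) * L[i].2, i.succ) ∧ y = ((δ : K), i.castSucc)) ∨
    (L[i].1 = -s ∧ x = ((δ : K), i.castSucc) ∧ y = ((δ : K) * L[i].2, i.succ))
  have r_neg (s x y) : r s x y → r (-s) y x := by
    rintro ⟨i, δ, h | h⟩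
    · exact ⟨i, δ, .inr ⟨by simpa using h.1, h.2.2, h.2.1⟩⟩
    · exact ⟨i, δ, .inl ⟨h.1, h.2.2, h.2.1⟩⟩
  have key (s : ℤˣ) (i j : Fin L.length) (δ δ' : Δ) (hi : L[i].1 = s) (hj : L[j].1 = -s)
      (h : ((δ : K) * L[i].2, i.succ) = ((δ' : K), j.castSucc)) : False := by
    rw [Prod.mk.injEq] at h
    have hij : (i : ℕ) + 1 = j := by simpa [Fin.ext_iff] using h.2
    have hmem : L[i].2 ∈ Δ := by
      have : L[i].2 = (δ : K)⁻¹ * δ' := by rw [← h.1]; group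
      rw [this]; exact Δ.mul_mem (Δ.inv_mem δ.2) δ'.2
    have h1 := List.isChain_iff_getElem.1 hL i (by rw [hij]; exact j.2) hmem
    have : L[i].1 = L[j].1 := by
      rw [Fin.getElem_fin, Fin.getElem_fin, h1]; congr 2
    rw [hi, hj] at this
    exact absurd this.symm (by rcases Int.units_eq_one_or s with rfl | rfl <;> decide)
  have hf (s x y y') : r s x y → r s x y' → y = y' := by
    rintro ⟨i, δ, ⟨h1, h2, h3⟩ | ⟨h1, h2, h3⟩⟩ ⟨j, δ', ⟨k1, k2, k3⟩ | ⟨k1, k2, k3⟩⟩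
    · rw [h2, Prod.mk.injEq] at k2
      obtain rfl := Fin.succ_injective _ k2.2
      rw [h3, k3, mul_right_cancel k2.1]
    · exact (key s i j δ δ' h1 k1 (h2.symm.trans k2)).elim
    · exact (key s j i δ' δ k1 h1 (k2.symm.trans h2)).elim
    · rw [h2, Prod.mk.injEq] at k2
      obtain rfl := Fin.castSucc_injective _ k2.2
      rw [h3, k3, k2.1]
  obtain ⟨σ, hσ, hσ'⟩ := exists_perm_sum_extending (r 1) (hf 1)
    (fun x x' y h h' => hf (-1) y x x' (r_neg _ _ _ h) (r_neg _ _ _ h'))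
  refine ⟨σ, fun δ hδ => hσ' _ ?_, ?_⟩
  · have h1 (δ : K) (hδ : δ ∈ Δ) (x y) (h : r 1 x y) :
        r 1 ((Equiv.mulLeft δ).prodCongr (Equiv.refl _) x)
          ((Equiv.mulLeft δ).prodCongr (Equiv.refl _) y) := by
      obtain ⟨i, δ', ⟨h1, rfl, rfl⟩ | ⟨h1, rfl, rfl⟩⟩ := h
      · exact ⟨i, ⟨δ, hδ⟩ * δ', .inl ⟨h1, by simp [mul_assoc], by simp⟩⟩
      · exact ⟨i, ⟨δ, hδ⟩ * δ', .inr ⟨h1, by simp, by simp [mul_assoc]⟩⟩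
    refine fun x y => ⟨fun h => ?_, h1 δ hδ x y⟩
    simpa [Prod.map] using h1 δ⁻¹ (Δ.inv_mem hδ) _ _ h
  · have step (i : ℕ) (hi : i < L.length) : (σ ^ (L[i].1 : ℤ) * leftMulSumHom K (Fin (L.length + 1)) L[i].2)
        (Sum.inl (1, (⟨i, hi⟩ : Fin L.length).succ)) =
        Sum.inl (1, (⟨i, hi⟩ : Fin L.length).castSucc) := by
      rw [Equiv.Perm.mul_apply, leftMulSumHom_inl, mul_one]
      rcases Int.units_eq_one_or L[i].1 with h | h
      · rw [h]
        simp only [Units.val_one, zpow_one]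
        exact hσ _ _ ⟨⟨i, hi⟩, 1, .inl ⟨h, by simp, by simp⟩⟩
      · rw [h]
        simp only [Units.val_neg, Units.val_one, zpow_neg, zpow_one]
        rw [Equiv.Perm.inv_eq_iff_eq]
        exact (hσ _ _ ⟨⟨i, hi⟩, 1, .inr ⟨h, by simp, by simp⟩⟩).symm
    have main (m : ℕ) (hm : m ≤ L.length) :
        ((L.drop m).map fun p => σ ^ (p.1 : ℤ) * leftMulSumHom K (Fin (L.length + 1)) p.2).prod
          (Sum.inl (1, Fin.last _)) = Sum.inl (1, ⟨m, by omega⟩) := by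
      induction hm using Nat.decreasingInduction with
      | self => simp [Fin.last]
      | of_succ m hm ih =>
        rw [List.drop_eq_getElem_cons hm, List.map_cons, List.prod_cons, Equiv.Perm.mul_apply, ih]
        exact step m hm
    simpa using main 0 (Nat.zero_le _)

/-- Finitely many elements which are detected by finite quotients are detected simultaneously. -/
theorem exists_finite_quotient_forall_ne_one {Γ : Type*} [Group Γ] (L : List Γ)
    (h : ∀ g ∈ L, g ≠ 1 → ∃ (K : Type) (_ : Group K) (_ : Finite K) (φ : Γ →* K), φ g ≠ 1) :
    ∃ (K : Type) (_ : Group K) (_ : Finite K) (φ : Γ →* K), ∀ g ∈ L, g ≠ 1 → φ g ≠ 1 := by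
  induction L with
  | nil => exact ⟨Unit, inferInstance, inferInstance, 1, by simp⟩
  | cons a L ih =>
    obtain ⟨K, _, _, φ, hφ⟩ := ih fun g hg => h g (List.mem_cons_of_mem _ hg)
    by_cases ha : a = 1
    · refine ⟨K, inferInstance, inferInstance, φ, fun g hg h1 => ?_⟩
      rcases List.mem_cons.1 hg with rfl | hg
      · exact (h1 ha).elim
      · exact hφ g hg h1
    · obtain ⟨K', _, _, φ', hφ'⟩ := h a List.mem_cons_self ha
      refine ⟨K × K', inferInstance, inferInstance, φ.prod φ', fun g hg h1 h2 => ?_⟩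
      rw [MonoidHom.prod_apply, Prod.mk_eq_one] at h2
      rcases List.mem_cons.1 hg with rfl | hg
      · exact hφ' h2.2
      · exact hφ g hg h1 h2.1

theorem IsRaag.detect_insert {V Γ : Type} [Group Γ] [Finite V] {E : V → V → Prop} {x : V → Γ}
    (hx : IsRaag E x) (v : V) (U : Set V) (hv : v ∉ U)
    (ih : ∀ g ∈ Subgroup.closure (x '' U), g ≠ 1 →
      ∃ (K : Type) (_ : Group K) (_ : Finite K) (φ : Γ →* K), φ g ≠ 1)
    (g : Γ) (hg : g ∈ Subgroup.closure (x '' insert v U)) (hg1 : g ≠ 1) :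
    ∃ (K : Type) (_ : Group K) (_ : Finite K) (φ : Γ →* K), φ g ≠ 1 := by
  classical
  let lk : Set V := {u ∈ U | E u v ∨ E v u}
  set H := Subgroup.closure (x '' U)
  set C := Subgroup.closure (x '' lk)
  have hCH : C ≤ H := Subgroup.closure_mono (Set.image_mono fun u hu => hu.1)
  have hCt : ∀ a ∈ C, Commute (x v) a := by
    intro a ha
    have : C ≤ Subgroup.centralizer {x v} := by
      refine (Subgroup.closure_le _).2 ?_
      rintro _ ⟨u, hu, rfl⟩
      rw [SetLike.mem_coe, Subgroup.mem_centralizer_singleton_iff]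
      rcases hu.2 with h | h
      · exact hx.commute _ _ h
      · exact (hx.commute _ _ h).symm
    exact (Subgroup.mem_centralizer_singleton_iff.1 (this ha)).symm
  obtain ⟨ρ, hρ⟩ := hx.exists_lift Γ (fun u => if u ∈ lk then x u else 1) (by
    intro u u' h
    split_ifs
    · exact hx.commute _ _ h
    · exact Commute.one_right _
    · exact Commute.one_left _
    · exact Commute.one_left _)
  have hρC : ∀ a ∈ C, ρ a = a := by
    intro a ha
    refine MonoidHom.eqOn_closure (g := MonoidHom.id Γ) ?_ ha
    rintro _ ⟨u, hu, rfl⟩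
    simp [hρ, hu]
  have hρmem (a : Γ) : ρ a ∈ C := by
    have : (⊤ : Subgroup Γ) ≤ C.comap ρ := by
      rw [← hx.closure_range, Subgroup.closure_le]
      rintro _ ⟨u, rfl⟩
      rw [SetLike.mem_coe, Subgroup.mem_comap, hρ]
      split_ifs with h
      · exact Subgroup.subset_closure ⟨u, h, rfl⟩
      · exact C.one_mem
    exact this (Subgroup.mem_top a)
  obtain ⟨h0, hh0, L, hLH, hL, rfl⟩ := exists_reduced_expression (x v) H (fun _ => (C : Set Γ))
    (by
      intro u a ha haC
      rw [((hCt a haC).zpow_left (u : ℤ)).eq, mul_inv_cancel_right]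
      exact ha)
    (by
      rw [Set.image_insert_eq, Set.insert_eq, Set.union_comm] at hg
      exact Subgroup.closure_mono (Set.union_subset_union_left _ Subgroup.subset_closure) hg)
  rcases eq_or_ne L [] with rfl | hLne
  · simp only [List.map_nil, List.prod_nil, mul_one] at hg1 ⊢
    exact ih _ hh0 hg1
  obtain ⟨K, _, _, φ, hφ⟩ := exists_finite_quotient_forall_ne_one
    (L.map fun p => p.2 * (ρ p.2)⁻¹) (by
      intro g hg hg1
      obtain ⟨p, hp, rfl⟩ := List.mem_map.1 hg
      exact ih _ (H.mul_mem (hLH p hp) (H.inv_mem (hCH (hρmem _)))) hg1)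
  let ψ : Γ →* K × K := φ.prod (φ.comp ρ)
  let Δ : Subgroup (K × K) := (MonoidHom.fst K K).eqLocus (MonoidHom.snd K K)
  have hψC (a : Γ) (ha : a ∈ C) : ψ a ∈ Δ := by
    change φ a = φ (ρ a)
    rw [hρC a ha]
  have hψL : ∀ p ∈ L, ψ p.2 ∈ Δ → p.2 ∈ C := by
    intro p hp h
    by_contra hpC
    refine hφ _ (List.mem_map_of_mem hp) (fun h1 => hpC ?_) ?_
    · rw [mul_inv_eq_one.1 h1]
      exact hρmem _
    · rw [map_mul, map_inv, mul_inv_eq_one]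
      exact h
  let L' : List (ℤˣ × (K × K)) := L.map fun p => (p.1, ψ p.2)
  have hL' : L'.IsChain fun a b => a.2 ∈ Δ → a.1 = b.1 := by
    rw [List.isChain_iff_getElem] at hL ⊢
    intro i hi h
    simp only [L', List.getElem_map] at h ⊢
    exact hL i (by simpa [L'] using hi) (hψL _ (List.getElem_mem _) h)
  obtain ⟨σ, hσ, hσL⟩ := exists_perm_path Δ L' hL'
  set μ := leftMulSumHom (K × K) (Fin (L'.length + 1))
  obtain ⟨Φ, hΦ⟩ := hx.exists_lift
    (Equiv.Perm (((K × K) × Fin (L'.length + 1)) ⊕ ((K × K) × Fin (L'.length + 1))))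
    (fun u => if u = v then σ else if u ∈ U then μ (ψ (x u)) else 1) (by
      have hlk (u) (hu : u ∈ lk) : Commute (μ (ψ (x u))) σ :=
        hσ _ (hψC _ (Subgroup.subset_closure ⟨u, hu, rfl⟩))
      intro u u' h
      split_ifs with h1 h2 h3 h4 h5 h6
      · exact Commute.refl _
      · exact (hlk u' ⟨h3, .inr (h1 ▸ h)⟩).symm
      · exact Commute.one_right _
      · exact hlk u ⟨h4, .inl (h5 ▸ h)⟩
      · exact ((hx.commute _ _ h).map ψ).map μ
      · exact Commute.one_right _
      · exact Commute.one_left _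
      · exact Commute.one_left _
      · exact Commute.one_left _)
  have hΦv : Φ (x v) = σ := by rw [hΦ, if_pos rfl]
  have hΦH : ∀ a ∈ H, Φ a = μ (ψ a) := by
    intro a ha
    refine MonoidHom.eqOn_closure (g := μ.comp ψ) ?_ ha
    rintro _ ⟨u, hu, rfl⟩
    rw [hΦ, if_neg (by rintro rfl; exact hv hu), if_pos hu]
    rfl
  refine ⟨_, inferInstance, inferInstance, Φ, fun h => ?_⟩
  have h2 : Φ ((L.map fun p => x v ^ (p.1 : ℤ) * p.2).prod) =
      (L'.map fun p => σ ^ (p.1 : ℤ) * μ p.2).prod := by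
    rw [map_list_prod, List.map_map, List.map_map]
    congr 1
    refine List.map_congr_left fun p hp => ?_
    simp [hΦv, hΦH _ (hLH p hp)]
  rw [map_mul, h2, hΦH _ hh0] at h
  have h3 := congrArg (fun π : Equiv.Perm _ => π (Sum.inl (1, Fin.last L'.length))) h
  simp only [Equiv.Perm.mul_apply, hσL, μ, leftMulSumHom_inl, Equiv.Perm.one_apply] at h3
  have h4 : (0 : Fin (L'.length + 1)) = Fin.last _ := (Prod.mk.inj (Sum.inl.inj h3)).2
  have h5 : L'.length = 0 := by simpa [Fin.ext_iff] using h4.symm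
  exact hLne (by simpa [L'] using h5)

/-- Right-angled Artin groups of finite graphs are residually finite. -/
theorem IsRaag.detect {V Γ : Type} [Group Γ] [Finite V] {E : V → V → Prop} {x : V → Γ}
    (hx : IsRaag E x) (g : Γ) (hg : g ≠ 1) :
    ∃ (K : Type) (_ : Group K) (_ : Finite K) (φ : Γ →* K), φ g ≠ 1 := by
  classical
  have key (U : Set V) : ∀ g ∈ Subgroup.closure (x '' U), g ≠ 1 →
      ∃ (K : Type) (_ : Group K) (_ : Finite K) (φ : Γ →* K), φ g ≠ 1 := by
    induction U, U.toFinite using Set.Finite.induction_on with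
    | empty => simp
    | @insert v U hv _ ih => exact hx.detect_insert v U hv ih
  exact key Set.univ g (by rw [Set.image_univ, hx.closure_range]; trivial) hg

/-- The vertices of the gadget graph that are not isolated. -/
inductive GadgetVertex (X ι : Type) : Type
  | xl (x : X)
  | xr (x : X)
  | y (i : X ⊕ ι)
  | z (i : X ⊕ ι)
  | a
  | d
  | l (i : Fin 3)

/-- The isolated vertices of the gadget graph. -/
abbrev GadgetIndex (X ι : Type) : Type := Bool ⊕ GadgetVertex X ι

/-- The adjacency relation of the gadget graph. -/
inductive GadgetAdj (X ι : Type) : GadgetVertex X ι ⊕ GadgetIndex X ι →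
    GadgetVertex X ι ⊕ GadgetIndex X ι → Prop
  | xl_xr (x x') : GadgetAdj X ι (.inl (.xl x)) (.inl (.xr x'))
  | xl_y (x i) : GadgetAdj X ι (.inl (.xl x)) (.inl (.y i))
  | xl_z (x i) : GadgetAdj X ι (.inl (.xl x)) (.inl (.z i))
  | xr_y (x i) : GadgetAdj X ι (.inl (.xr x)) (.inl (.y i))
  | xr_z (x i) : GadgetAdj X ι (.inl (.xr x)) (.inl (.z i))
  | y_z (i i') : GadgetAdj X ι (.inl (.y i)) (.inl (.z i'))
  | a_z (i) : GadgetAdj X ι (.inl .a) (.inl (.z i))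
  | d_y (i) : GadgetAdj X ι (.inl .d) (.inl (.y i))
  | a_d : GadgetAdj X ι (.inl .a) (.inl .d)
  | l_of (i v) (hv : ∀ j, v ≠ GadgetVertex.l j) : GadgetAdj X ι (.inl (.l i)) (.inl v)

/-- The index type of the generators of the gadget subgroup. -/
inductive GadgetGen (X ι : Type) : Type
  | delta (i : X ⊕ ι)
  | alpha
  | beta
  | s (j : GadgetIndex X ι)
  | zeta (j : GadgetIndex X ι)

instance {X ι : Type} [Finite X] [Finite ι] : Finite (GadgetVertex X ι) := by
  refine Finite.of_injective
    (β := (X ⊕ X) ⊕ ((X ⊕ ι) ⊕ (X ⊕ ι)) ⊕ (Bool ⊕ Fin 3)) (fun v => match v with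
    | .xl x => .inl (.inl x)
    | .xr x => .inl (.inr x)
    | .y i => .inr (.inl (.inl i))
    | .z i => .inr (.inl (.inr i))
    | .a => .inr (.inr (.inl true))
    | .d => .inr (.inr (.inl false))
    | .l i => .inr (.inr (.inr i))) ?_
  intro v v' h
  cases v <;> cases v' <;> simp_all

instance {X ι : Type} [Finite X] [Finite ι] : Finite (GadgetGen X ι) := by
  refine Finite.of_injective
    (β := (X ⊕ ι) ⊕ Bool ⊕ (GadgetIndex X ι ⊕ GadgetIndex X ι)) (fun v => match v with
    | .delta i => .inl i
    | .alpha => .inr (.inl true)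
    | .beta => .inr (.inl false)
    | .s i => .inr (.inr (.inl i))
    | .zeta i => .inr (.inr (.inr i))) ?_
  intro v v' h
  cases v <;> cases v' <;> simp_all

section Gadget

variable {X ι Γ : Type} [Group Γ] (rel : ι → FreeGroup X)
  (γ : GadgetVertex X ι ⊕ GadgetIndex X ι → Γ)

/-- The image of a word on the right-hand copy of the generators `X`. -/
abbrev gadgetRight : FreeGroup X →* Γ := FreeGroup.lift fun x => γ (.inl (.xr x))

/-- The commutator of the first two vertices of the free part. -/
abbrev gadgetCommutator : Γ :=
  γ (.inl (.l 0)) * γ (.inl (.l 1)) * (γ (.inl (.l 0)))⁻¹ * (γ (.inl (.l 1)))⁻¹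

/-- The group element attached to the index of an isolated vertex. -/
abbrev gadgetTarget : GadgetIndex X ι → Γ := Sum.elim (fun _ => 1) fun v => γ (.inl v)

/-- The generators of the gadget subgroup. -/
def gadgetGen (w : FreeGroup X) : GadgetGen X ι → Γ
  | .delta (.inl x) => γ (.inl (.xl x)) * γ (.inl (.xr x)) * γ (.inl (.y (.inl x))) *
      γ (.inl (.z (.inl x)))
  | .delta (.inr r) => gadgetRight γ (rel r) * γ (.inl (.y (.inr r))) * γ (.inl (.z (.inr r)))
  | .alpha => (gadgetRight γ w)⁻¹ * γ (.inl .a) * gadgetRight γ w * γ (.inl (.l 0))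
  | .beta => γ (.inl .d) * γ (.inl (.l 1))
  | .s j => γ (.inr j)
  | .zeta j => gadgetCommutator γ * γ (.inr j) * (gadgetTarget γ j * γ (.inl (.l 2)))

theorem map_gadgetGen {Γ' : Type} [Group Γ'] (f : Γ →* Γ') (w : FreeGroup X)
    (n : GadgetGen X ι) : f (gadgetGen rel γ w n) = gadgetGen rel (fun v => f (γ v)) w n := by
  have h : f.comp (gadgetRight γ) = gadgetRight fun v => f (γ v) := by ext; simp
  have h' (u) : f (gadgetRight γ u) = gadgetRight (fun v => f (γ v)) u := by rw [← h]; rfl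
  rcases n with (x | r) | _ | _ | j | (j | j) <;> simp [gadgetGen, h', -FreeGroup.lift_apply_of]

theorem commute_freeGroup_lift {α G : Type*} [Group G] {f : α → G} {b : G}
    (h : ∀ x, Commute (f x) b) (u : FreeGroup α) : Commute (FreeGroup.lift f u) b := by
  induction u using FreeGroup.induction_on with
  | C1 => simp
  | of x => simpa using h x
  | inv_of x ih => rw [map_inv]; exact ih.inv_left
  | mul u v hu hv => rw [map_mul]; exact hu.mul_left hv

theorem commute_freeGroup_lift_lift {α β G : Type*} [Group G] {f : α → G} {g : β → G}
    (h : ∀ x y, Commute (f x) (g y)) (u : FreeGroup α) (v : FreeGroup β) :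
    Commute (FreeGroup.lift f u) (FreeGroup.lift g v) :=
  commute_freeGroup_lift (fun x => (commute_freeGroup_lift (fun y => (h x y).symm) v).symm) u

variable {rel γ}

theorem commutator_conj_eq {G : Type*} [Group G] {a d l m w y z : G} (had : Commute a d)
    (haz : Commute z a) (hyd : Commute y d) (hwy : Commute w y) (hwz : Commute w z)
    (hwl : Commute w l) (hwm : Commute w m) (hal : Commute a l) (ham : Commute a m)
    (hdl : Commute d l) (hdm : Commute d m) (hym : Commute y m) (hzl : Commute z l)
    (hzm : Commute z m) :
    (w⁻¹ * a * w * l) * ((w * y * z)⁻¹ * (d * m) * (w * y * z)) * (w⁻¹ * a * w * l)⁻¹ *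
      ((w * y * z)⁻¹ * (d * m) * (w * y * z))⁻¹ = l * m * l⁻¹ * m⁻¹ := by
  have h1 : (w * y * z)⁻¹ * (d * m) * (w * y * z) = w⁻¹ * (z⁻¹ * d * z) * w * m := by
    rw [hwy.eq]
    calc (y * w * z)⁻¹ * (d * m) * (y * w * z) = (w * z)⁻¹ * (y⁻¹ * (d * m) * y) * (w * z) := by
          group
      _ = (w * z)⁻¹ * d * (m * (w * z)) := by
        rw [(hyd.mul_right hym).inv_mul_cancel]; group
      _ = _ := by rw [← (hwm.mul_left hzm).eq, hwz.eq]; group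
  have hD {g : G} (hz : Commute z g) (hd : Commute d g) (hw : Commute w g) :
      Commute (w⁻¹ * (z⁻¹ * d * z) * w) g :=
    (hw.inv_left.mul_left ((hz.inv_left.mul_left hd).mul_left hz)).mul_left hw
  have hA {g : G} (ha : Commute a g) (hw : Commute w g) : Commute (w⁻¹ * a * w) g :=
    (hw.inv_left.mul_left ha).mul_left hw
  have hAD : Commute (w⁻¹ * a * w) (w⁻¹ * (z⁻¹ * d * z) * w) := by
    have : Commute a (z⁻¹ * d * z) := (haz.symm.inv_right.mul_right had).mul_right haz.symm
    simpa using this.map (MulAut.conj w⁻¹).toMonoidHom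
  rw [h1]
  have hDl := hD hzl hdl hwl
  have hDm := hD hzm hdm hwm
  have hAl := hA hal hwl
  have hAm := hA ham hwm
  generalize w⁻¹ * a * w = A at *
  generalize w⁻¹ * (z⁻¹ * d * z) * w = D at *
  calc A * l * (D * m) * (A * l)⁻¹ * (D * m)⁻¹ =
        (A * l * D) * m * l⁻¹ * A⁻¹ * m⁻¹ * D⁻¹ := by group
    _ = D * (A * (l * m * l⁻¹) * A⁻¹) * m⁻¹ * D⁻¹ := by
      rw [← (hAD.symm.mul_right hDl).eq]; group
    _ = D * (l * m * l⁻¹ * m⁻¹) * D⁻¹ := by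
      rw [((hAl.mul_right hAm).mul_right hAl.inv_right).mul_inv_cancel]; group
    _ = _ := (((hDl.mul_right hDm).mul_right hDl.inv_right).mul_right hDm.inv_right).mul_inv_cancel

theorem closure_gadgetGen_eq_top (hγ : IsRaag (GadgetAdj X ι) γ) {w : FreeGroup X}
    (hw : w ∈ Subgroup.normalClosure (Set.range rel)) :
    Subgroup.closure (Set.range (gadgetGen rel γ w)) = ⊤ := by
  have hc := hγ.commute
  let Y : FreeGroup (X ⊕ ι) →* Γ := FreeGroup.lift fun i => γ (.inl (.y i))
  let Z : FreeGroup (X ⊕ ι) →* Γ := FreeGroup.lift fun i => γ (.inl (.z i))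
  let xl : FreeGroup X →* Γ := FreeGroup.lift fun x => γ (.inl (.xl x))
  let R : FreeGroup X →* Γ := gadgetRight γ
  have xl_R (u v) : Commute (xl u) (R v) :=
    commute_freeGroup_lift_lift (fun _ _ => hc _ _ (.xl_xr _ _)) _ _
  have xl_Y (u v) : Commute (xl u) (Y v) :=
    commute_freeGroup_lift_lift (fun _ _ => hc _ _ (.xl_y _ _)) _ _
  have xl_Z (u v) : Commute (xl u) (Z v) :=
    commute_freeGroup_lift_lift (fun _ _ => hc _ _ (.xl_z _ _)) _ _
  have R_Y (u v) : Commute (R u) (Y v) :=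
    commute_freeGroup_lift_lift (fun _ _ => hc _ _ (.xr_y _ _)) _ _
  have R_Z (u v) : Commute (R u) (Z v) :=
    commute_freeGroup_lift_lift (fun _ _ => hc _ _ (.xr_z _ _)) _ _
  have Y_Z (u v) : Commute (Y u) (Z v) :=
    commute_freeGroup_lift_lift (fun _ _ => hc _ _ (.y_z _ _)) _ _
  have Z_a (u) : Commute (Z u) (γ (.inl .a)) :=
    commute_freeGroup_lift (fun _ => (hc _ _ (.a_z _)).symm) _
  have Y_d (u) : Commute (Y u) (γ (.inl .d)) :=
    commute_freeGroup_lift (fun _ => (hc _ _ (.d_y _)).symm) _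
  have R_l (u i) : Commute (R u) (γ (.inl (.l i))) :=
    commute_freeGroup_lift (fun _ => (hc _ _ (.l_of _ _ (by simp))).symm) _
  have Y_l (u i) : Commute (Y u) (γ (.inl (.l i))) :=
    commute_freeGroup_lift (fun _ => (hc _ _ (.l_of _ _ (by simp))).symm) _
  have Z_l (u i) : Commute (Z u) (γ (.inl (.l i))) :=
    commute_freeGroup_lift (fun _ => (hc _ _ (.l_of _ _ (by simp))).symm) _
  have a_l (i) : Commute (γ (.inl .a)) (γ (.inl (.l i))) := (hc _ _ (.l_of _ _ (by simp))).symm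
  have d_l (i) : Commute (γ (.inl .d)) (γ (.inl (.l i))) := (hc _ _ (.l_of _ _ (by simp))).symm
  have a_d : Commute (γ (.inl .a)) (γ (.inl .d)) := hc _ _ .a_d
  let A : FreeGroup (X ⊕ ι) →* Γ := FreeGroup.lift
    (Sum.elim (fun x => xl (.of x) * R (.of x)) fun r => R (rel r))
  have A_Y (u v) : Commute (A u) (Y v) := commute_freeGroup_lift (by
    rintro (x | r)
    · exact (xl_Y _ _).mul_left (R_Y _ _)
    · exact R_Y _ _) _
  have A_Z (u v) : Commute (A u) (Z v) := commute_freeGroup_lift (by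
    rintro (x | r)
    · exact (xl_Z _ _).mul_left (R_Z _ _)
    · exact R_Z _ _) _
  set P := Subgroup.closure (Set.range (gadgetGen rel γ w)) with hP
  have mem (n) : gadgetGen rel γ w n ∈ P := Subgroup.subset_closure ⟨n, rfl⟩
  have hD (f) : A f * Y f * Z f ∈ P := by
    induction f using FreeGroup.induction_on with
    | C1 => simp [P.one_mem]
    | of i =>
      have := mem (.delta i)
      rcases i with x | r
      · simpa [gadgetGen, A, Y, Z, xl, R, gadgetRight] using this
      · simpa [gadgetGen, A, Y, Z, xl, R, gadgetRight] using this
    | inv_of i ih =>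
      have := P.inv_mem ih
      rw [mul_inv_rev, mul_inv_rev, ← map_inv, ← map_inv, ← map_inv] at this
      rwa [((A_Z _ _).mul_left (Y_Z _ _)).eq, (A_Y _ _).eq]
    | mul f g hf hg =>
      have := P.mul_mem hf hg
      convert this using 1
      rw [map_mul, map_mul, map_mul]
      calc A f * A g * (Y f * Y g) * (Z f * Z g) = A f * (A g * Y f) * (Y g * Z f) * Z g := by
            group
        _ = A f * Y f * (A g * Z f) * Y g * Z g := by rw [(A_Y _ _).eq, (Y_Z _ _).eq]; group
        _ = _ := by rw [(A_Z _ _).eq]; group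
  obtain ⟨f, hf⟩ : ∃ f, A f = R w := by
    have hn : (A.range.comap R).Normal := by
      refine ⟨fun u ⟨f, hf⟩ g => ⟨FreeGroup.map .inl g * f * (FreeGroup.map .inl g)⁻¹, ?_⟩⟩
      have hA : A (FreeGroup.map .inl g) = xl g * R g := by
        induction g using FreeGroup.induction_on with
        | C1 => simp
        | of x => simp [A]
        | inv_of x ih => rw [map_inv, map_inv, ih, (xl_R _ _).eq, mul_inv_rev, map_inv, map_inv]
        | mul g h hg hh =>
          rw [map_mul, map_mul, hg, hh, map_mul, map_mul, mul_assoc, ← mul_assoc (R g),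
            ← (xl_R _ _).eq]
          group
      rw [map_mul, map_mul, map_inv, hA, hf, mul_inv_rev, map_mul, map_mul, map_inv]
      have := (xl_R g (g * u * g⁻¹)).eq
      rw [map_mul, map_mul, map_inv] at this
      calc xl g * R g * R u * ((R g)⁻¹ * (xl g)⁻¹) = xl g * (R g * R u * (R g)⁻¹) * (xl g)⁻¹ := by
            group
        _ = _ := by rw [this]; group
    refine (Subgroup.normalClosure_le_normal (N := A.range.comap R) ?_) hw
    rintro _ ⟨r, rfl⟩
    exact ⟨.of (.inr r), by simp [A]⟩
  have hδ := hD f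
  rw [hf] at hδ
  have e_mem : gadgetCommutator γ ∈ P := by
    have hα := mem .alpha
    have hβ := mem .beta
    simp only [gadgetGen] at hα hβ
    have hδβ := P.mul_mem (P.mul_mem (P.inv_mem hδ) hβ) hδ
    have := P.mul_mem (P.mul_mem (P.mul_mem hα hδβ) (P.inv_mem hα)) (P.inv_mem hδβ)
    rwa [commutator_conj_eq a_d (Z_a _) (Y_d _) (R_Y _ _) (R_Z _ _) (R_l _ _) (R_l _ _) (a_l _)
      (a_l _) (d_l _) (d_l _) (Y_l _ _) (Z_l _ _) (Z_l _ _)] at this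
  have s_mem (j) : γ (.inr j) ∈ P := mem (.s j)
  have t_mem (j) : gadgetTarget γ j * γ (.inl (.l 2)) ∈ P := by
    have := mem (.zeta j)
    rw [gadgetGen, Subgroup.mul_mem_cancel_left _ (P.mul_mem e_mem (s_mem j))] at this
    exact this
  have l_mem : γ (.inl (.l 2)) ∈ P := by simpa using t_mem (.inl true)
  rw [← top_le_iff, ← hγ.closure_range, Subgroup.closure_le]
  rintro _ ⟨v | j, rfl⟩
  · have := t_mem (.inr v)
    rwa [Subgroup.mul_mem_cancel_right _ l_mem] at this
  · exact s_mem j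

end Gadget

section GadgetFree

variable {X ι : Type} (rel : ι → FreeGroup X) (w : FreeGroup X)

/-- The finite-index-free permutation model of the gadget group: the points. -/
abbrev GadgetPoint : Type :=
  PresentedGroup (Set.range rel) × FreeGroup (X ⊕ ι) × FreeGroup (GadgetGen X ι) ×
    (Equiv.Perm (Fin 3) × Multiplicative ℤ)

/-- The images of the three free vertices in the auxiliary group. -/
def gadgetFree : Fin 3 → Equiv.Perm (Fin 3) × Multiplicative ℤ :=
  ![(Equiv.swap 0 1, 1), (Equiv.swap 1 2, 1), (1, Multiplicative.ofAdd 1)]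

/-- The label of a word in the generators of the gadget subgroup. -/
def gadgetLabel : FreeGroup (GadgetGen X ι) →* Equiv.Perm (Fin 3) × Multiplicative ℤ :=
  FreeGroup.lift fun n => match n with
    | .alpha => gadgetFree 0
    | .beta => gadgetFree 1
    | _ => 1

/-- The point at a given word in the generators of the gadget subgroup. -/
def gadgetPoint (p : FreeGroup (GadgetGen X ι)) : GadgetPoint rel := (1, 1, p, gadgetLabel p)

open Classical in
/-- Left multiplication in the third coordinate at the points with prescribed first coordinate. -/
noncomputable def gadgetCond (q : PresentedGroup (Set.range rel))
    (f : FreeGroup (X ⊕ ι) → FreeGroup (GadgetGen X ι)) : Equiv.Perm (GadgetPoint rel) where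
  toFun t := if t.1 = q then (t.1, t.2.1, f t.2.1 * t.2.2.1, t.2.2.2) else t
  invFun t := if t.1 = q then (t.1, t.2.1, (f t.2.1)⁻¹ * t.2.2.1, t.2.2.2) else t
  left_inv t := by by_cases h : t.1 = q <;> simp [h]; simp [← h]
  right_inv t := by by_cases h : t.1 = q <;> simp [h]; simp [← h]

/-- The action of the vertices of the gadget graph on points. -/
noncomputable def gadgetAct : GadgetVertex X ι → Equiv.Perm (GadgetPoint rel)
  | .xl x => (Equiv.mulLeft (.of x)).prodCongr (.refl _)
  | .xr x => (Equiv.mulRight (PresentedGroup.of x)⁻¹).prodCongr (.refl _)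
  | .y i => (Equiv.refl _).prodCongr ((Equiv.mulLeft (.of i)).prodCongr (.refl _))
  | .z i => (Equiv.refl _).prodCongr ((Equiv.mulRight (FreeGroup.of i)⁻¹).prodCongr
      ((Equiv.mulLeft (.of (.delta i))).prodCongr (.refl _)))
  | .a => gadgetCond rel (PresentedGroup.mk _ w)⁻¹ fun h =>
      (FreeGroup.map .delta h)⁻¹ * .of .alpha * FreeGroup.map .delta h
  | .d => gadgetCond rel 1 fun _ => .of .beta
  | .l i => (Equiv.refl _).prodCongr ((Equiv.refl _).prodCongr
      ((Equiv.refl _).prodCongr (Equiv.mulLeft (gadgetFree i))))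

variable {rel w}

theorem commute_gadgetAct (hw : w ∉ Subgroup.normalClosure (Set.range rel))
    {v v' : GadgetVertex X ι} (h : GadgetAdj X ι (.inl v) (.inl v')) :
    Commute (gadgetAct rel w v) (gadgetAct rel w v') := by
  have hw' : (PresentedGroup.mk (Set.range rel) w)⁻¹ ≠ 1 := by
    rw [Ne, inv_eq_one]
    intro h
    exact hw ((QuotientGroup.eq_one_iff w).1 h)
  rw [commute_iff_eq]
  ext1 ⟨q, f, p, t⟩
  simp only [Equiv.Perm.mul_apply]
  cases h with
  | xl_xr x x' => simp [gadgetAct, mul_assoc]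
  | xl_y x i => simp [gadgetAct]
  | xl_z x i => simp [gadgetAct]
  | xr_y x i => simp [gadgetAct]
  | xr_z x i => simp [gadgetAct]
  | y_z i i' => simp [gadgetAct, mul_assoc]
  | a_z i =>
    simp only [gadgetAct, gadgetCond, Equiv.coe_fn_mk, Equiv.prodCongr_apply, Prod.map]
    split_ifs <;> simp_all [mul_assoc]
  | d_y i =>
    simp only [gadgetAct, gadgetCond, Equiv.coe_fn_mk, Equiv.prodCongr_apply, Prod.map]
    split_ifs <;> simp_all
  | a_d =>
    simp only [gadgetAct, gadgetCond, Equiv.coe_fn_mk]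
    by_cases h1 : q = 1
    · simp [h1, hw'.symm]
    · by_cases h2 : q = (PresentedGroup.mk (Set.range rel) w)⁻¹
      · simp [h2, hw']
      · simp [h1, h2]
  | l_of i v hv =>
    cases v' with
    | l j => exact (hv j rfl).elim
    | a =>
      simp only [gadgetAct, gadgetCond, Equiv.coe_fn_mk, Equiv.prodCongr_apply, Prod.map]
      split_ifs <;> simp_all
    | d =>
      simp only [gadgetAct, gadgetCond, Equiv.coe_fn_mk, Equiv.prodCongr_apply, Prod.map]
      split_ifs <;> simp_all
    | _ => simp [gadgetAct]

theorem gadgetRight_gadgetAct (γ : GadgetVertex X ι ⊕ GadgetIndex X ι → Equiv.Perm (GadgetPoint rel))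
    (hγ : ∀ v, γ (.inl v) = gadgetAct rel w v) (u : FreeGroup X) (t : GadgetPoint rel) :
    gadgetRight γ u t = (t.1 * (PresentedGroup.mk _ u)⁻¹, t.2) := by
  let f : PresentedGroup (Set.range rel) →* Equiv.Perm (GadgetPoint rel) :=
    { toFun := fun q => (Equiv.mulRight q⁻¹).prodCongr (.refl _)
      map_one' := by ext1 t; simp
      map_mul' := fun a b => by ext1 t; simp [Prod.map, mul_assoc] }
  have : gadgetRight γ = f.comp (PresentedGroup.mk (Set.range rel)) := by
    ext1 x
    simp only [FreeGroup.lift_apply_of, hγ, gadgetAct]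
    rfl
  rw [this]
  rfl

theorem gadgetCommutator_gadgetAct
    (γ : GadgetVertex X ι ⊕ GadgetIndex X ι → Equiv.Perm (GadgetPoint rel))
    (hγ : ∀ v, γ (.inl v) = gadgetAct rel w v) (t : GadgetPoint rel) :
    gadgetCommutator γ t = (t.1, t.2.1, t.2.2.1, gadgetFree 0 * gadgetFree 1 *
      (gadgetFree 0)⁻¹ * (gadgetFree 1)⁻¹ * t.2.2.2) := by
  have (i : Fin 3) : (gadgetAct rel w (.l i))⁻¹ = (Equiv.refl _).prodCongr ((Equiv.refl _).prodCongr
      ((Equiv.refl _).prodCongr (Equiv.mulLeft (gadgetFree i)⁻¹))) := by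
    rw [inv_eq_iff_mul_eq_one]
    ext1 t
    simp [gadgetAct, Prod.map]
  simp only [gadgetCommutator, hγ, this]
  simp [gadgetAct, mul_assoc, Prod.map]

theorem gadgetFree_commutator_ne_one :
    gadgetFree 0 * gadgetFree 1 * (gadgetFree 0)⁻¹ * (gadgetFree 1)⁻¹ ≠ 1 := by
  intro h
  have := congrArg Prod.fst h
  revert this
  decide

theorem le_toAdd_gadgetAct (v : GadgetVertex X ι) (t : GadgetPoint rel) :
    (t.2.2.2.2).toAdd ≤ (gadgetAct rel w v t).2.2.2.2.toAdd := by
  cases v with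
  | l i => fin_cases i <;> simp [gadgetAct, gadgetFree]
  | a => simp only [gadgetAct, gadgetCond, Equiv.coe_fn_mk]; split_ifs <;> simp
  | d => simp only [gadgetAct, gadgetCond, Equiv.coe_fn_mk]; split_ifs <;> simp
  | _ => simp [gadgetAct]

theorem toAdd_gadgetLabel (p : FreeGroup (GadgetGen X ι)) : (gadgetLabel p).2.toAdd = 0 := by
  have : (MonoidHom.snd _ _).comp (gadgetLabel (X := X) (ι := ι)) = 1 := by
    ext n
    cases n <;> simp [gadgetLabel, gadgetFree]
  exact congrArg Multiplicative.toAdd (DFunLike.congr_fun this p)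

theorem lift_gadgetGen_injective {Γ : Type} [Group Γ]
    {γ : GadgetVertex X ι ⊕ GadgetIndex X ι → Γ} (hγ : IsRaag (GadgetAdj X ι) γ)
    (hw : w ∉ Subgroup.normalClosure (Set.range rel)) :
    Function.Injective (FreeGroup.lift (gadgetGen rel γ w)) := by
  let γ₀ : GadgetVertex X ι ⊕ GadgetIndex X ι → Equiv.Perm (GadgetPoint rel) :=
    Sum.elim (gadgetAct rel w) 1
  have hγ₀ (v) : γ₀ (.inl v) = gadgetAct rel w v := rfl
  have hτ (k : GadgetIndex X ι) : ∃ τ : Equiv.Perm (GadgetPoint rel ⊕ GadgetPoint rel),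
      (∀ p, τ (.inl (gadgetPoint rel p)) = .inl (gadgetPoint rel (.of (.s k) * p))) ∧
      ∀ p, τ (.inl ((gadgetTarget γ₀ k * γ₀ (.inl (.l 2))) (gadgetPoint rel p))) =
        .inl ((gadgetCommutator γ₀)⁻¹ (gadgetPoint rel (.of (.zeta k) * p))) := by
    let r (x y : GadgetPoint rel) : Prop := ∃ p,
      (x = gadgetPoint rel p ∧ y = gadgetPoint rel (.of (.s k) * p)) ∨
      (x = (gadgetTarget γ₀ k * γ₀ (.inl (.l 2))) (gadgetPoint rel p) ∧
        y = (gadgetCommutator γ₀)⁻¹ (gadgetPoint rel (.of (.zeta k) * p)))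
    have inj {p p'} (h : gadgetPoint rel p = gadgetPoint rel p') : p = p' :=
      congrArg (fun t => t.2.2.1) h
    have hne (p p') : gadgetPoint rel p ≠
        (gadgetTarget γ₀ k * γ₀ (.inl (.l 2))) (gadgetPoint rel p') := by
      intro h
      have h0 (p) : (gadgetPoint rel p).2.2.2.2.toAdd = 0 := toAdd_gadgetLabel p
      have h1 : (γ₀ (.inl (.l 2)) (gadgetPoint rel p')).2.2.2.2.toAdd = 1 := by
        have := h0 p'
        simp only [hγ₀, gadgetAct, gadgetFree, Equiv.prodCongr_apply, Prod.map]
        simpa using this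
      have h2 (t) : t.2.2.2.2.toAdd ≤ (gadgetTarget γ₀ k t).2.2.2.2.toAdd := by
        rcases k with k | k
        · simp
        · exact le_toAdd_gadgetAct k t
      have h3 := h2 (γ₀ (.inl (.l 2)) (gadgetPoint rel p'))
      rw [h1, ← Equiv.Perm.mul_apply, ← h, h0] at h3
      omega
    have hne' (p p') : gadgetPoint rel p ≠ (gadgetCommutator γ₀)⁻¹ (gadgetPoint rel p') := by
      intro h
      rw [Equiv.Perm.eq_inv_iff_eq, gadgetCommutator_gadgetAct γ₀ hγ₀] at h
      have h1 : p = p' := congrArg (fun t => t.2.2.1) h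
      subst h1
      exact gadgetFree_commutator_ne_one (mul_eq_right.1 (congrArg (fun t => t.2.2.2) h))
    obtain ⟨τ, hτ, -⟩ := exists_perm_sum_extending r
      (by
        rintro x y y' ⟨p, ⟨h1, h2⟩ | ⟨h1, h2⟩⟩ ⟨p', ⟨k1, k2⟩ | ⟨k1, k2⟩⟩
        · rw [h2, k2, inj (h1.symm.trans k1)]
        · exact (hne _ _ (h1.symm.trans k1)).elim
        · exact (hne _ _ (k1.symm.trans h1)).elim
        · rw [h2, k2, inj ((Equiv.injective _) (h1.symm.trans k1))])
      (by
        rintro x x' y ⟨p, ⟨h1, h2⟩ | ⟨h1, h2⟩⟩ ⟨p', ⟨k1, k2⟩ | ⟨k1, k2⟩⟩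
        · rw [h1, k1, mul_left_cancel (inj (h2.symm.trans k2))]
        · exact (hne' _ _ (h2.symm.trans k2)).elim
        · exact (hne' _ _ (k2.symm.trans h2)).elim
        · rw [h1, k1, mul_left_cancel (inj ((Equiv.injective _) (h2.symm.trans k2)))])
    exact ⟨τ, fun p => hτ _ _ ⟨p, .inl ⟨rfl, rfl⟩⟩, fun p => hτ _ _ ⟨p, .inr ⟨rfl, rfl⟩⟩⟩
  choose τ hτs hτz using hτ
  let S : Equiv.Perm (GadgetPoint rel) →* Equiv.Perm (GadgetPoint rel ⊕ GadgetPoint rel) :=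
    (Equiv.Perm.sumCongrHom _ _).comp ((MonoidHom.id _).prod (MonoidHom.id _))
  have hS (π t) : S π (.inl t) = .inl (π t) := rfl
  let γ₁ : GadgetVertex X ι ⊕ GadgetIndex X ι →
    Equiv.Perm (GadgetPoint rel ⊕ GadgetPoint rel) := Sum.elim (fun v => S (gadgetAct rel w v)) τ
  obtain ⟨Φ, hΦ⟩ := hγ.exists_lift _ γ₁ (by
    intro u v h
    rcases u with u | u <;> rcases v with v | v
    · exact (commute_gadgetAct hw h).map S
    all_goals cases h)
  have hdelta (p i) : gadgetGen rel γ₀ w (.delta i) (gadgetPoint rel p) =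
      gadgetPoint rel (.of (.delta i) * p) := by
    have hl : gadgetLabel (FreeGroup.of (.delta i) * p) = gadgetLabel p := by
      simp [gadgetLabel]
    rw [gadgetPoint, gadgetPoint, hl]
    rcases i with x | r
    · simp [gadgetGen, hγ₀, gadgetAct, Prod.map]
    · simp only [gadgetGen, Equiv.Perm.mul_apply, gadgetRight_gadgetAct γ₀ hγ₀]
      have : PresentedGroup.mk (Set.range rel) (rel r) = 1 :=
        PresentedGroup.one_of_mem ⟨r, rfl⟩
      simp [this, hγ₀, gadgetAct, Prod.map]
  have halpha (p) : gadgetGen rel γ₀ w .alpha (gadgetPoint rel p) =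
      gadgetPoint rel (.of .alpha * p) := by
    have hl : gadgetLabel (FreeGroup.of (.alpha) * p) = gadgetFree 0 * gadgetLabel p := by
      simp [gadgetLabel]
    rw [gadgetPoint, gadgetPoint, hl]
    simp only [gadgetGen, Equiv.Perm.mul_apply, Equiv.Perm.inv_eq_iff_eq,
      gadgetRight_gadgetAct γ₀ hγ₀]
    simp [hγ₀, gadgetAct, gadgetCond]
  have hbeta (p) : gadgetGen rel γ₀ w .beta (gadgetPoint rel p) =
      gadgetPoint rel (.of .beta * p) := by
    have hl : gadgetLabel (FreeGroup.of (.beta) * p) = gadgetFree 1 * gadgetLabel p := by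
      simp [gadgetLabel]
    rw [gadgetPoint, gadgetPoint, hl]
    simp [gadgetGen, hγ₀, gadgetAct, gadgetCond]
  have step (n p) : gadgetGen rel γ₁ w n (.inl (gadgetPoint rel p)) =
      .inl (gadgetPoint rel (.of n * p)) := by
    cases n with
    | delta i =>
      rw [← hdelta, ← hS, map_gadgetGen]
      rcases i with x | r <;> rfl
    | alpha => rw [← halpha, ← hS, map_gadgetGen]; rfl
    | beta => rw [← hbeta, ← hS, map_gadgetGen]; rfl
    | s k => exact hτs k p
    | zeta k =>
      have h1 : gadgetCommutator γ₁ = S (gadgetCommutator γ₀) := by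
        simp only [gadgetCommutator, map_mul, map_inv]; rfl
      have h2 : gadgetTarget γ₁ k * γ₁ (.inl (.l 2)) =
          S (gadgetTarget γ₀ k * γ₀ (.inl (.l 2))) := by
        rw [map_mul]
        rcases k with k | k
        · simp only [gadgetTarget, Sum.elim_inl, map_one]; rfl
        · rfl
      rw [gadgetGen, h1, h2, Equiv.Perm.mul_apply, Equiv.Perm.mul_apply, hS]
      change S _ (τ k _) = _
      rw [hτz, hS]
      exact congrArg Sum.inl (Equiv.apply_symm_apply _ _)
  have main (u : FreeGroup (GadgetGen X ι)) : ∀ p,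
      Φ (FreeGroup.lift (gadgetGen rel γ w) u) (.inl (gadgetPoint rel p)) =
        .inl (gadgetPoint rel (u * p)) := by
    have hgen (n) : Φ (gadgetGen rel γ w n) = gadgetGen rel γ₁ w n := by
      rw [map_gadgetGen]
      congr 1
      exact funext hΦ
    induction u using FreeGroup.induction_on with
    | C1 => simp
    | of n => intro p; rw [FreeGroup.lift_apply_of, hgen, step]
    | inv_of n ih =>
      intro p
      rw [_root_.map_inv, _root_.map_inv, Equiv.Perm.inv_eq_iff_eq, ih, mul_inv_cancel_left]
    | mul u u' hu hu' =>
      intro p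
      rw [_root_.map_mul, _root_.map_mul, Equiv.Perm.mul_apply, hu', hu, mul_assoc]
  rw [injective_iff_map_eq_one]
  intro u hu
  have := main u 1
  rw [hu, map_one, Equiv.Perm.one_apply, mul_one] at this
  exact (congrArg (fun t => t.2.2.1) (Sum.inl.inj this)).symm

end GadgetFree

theorem profiniteSurj_top (Γ : Type*) [Group Γ] : ProfiniteSurj (⊤ : Subgroup Γ) := by
  intro H _ _ f hf h
  obtain ⟨g, rfl⟩ := hf h
  exact ⟨⟨g, trivial⟩, rfl⟩

theorem profiniteInj_top (Γ : Type*) [Group Γ] : ProfiniteInj (⊤ : Subgroup Γ) := by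
  intro M _ _
  refine ⟨M.map Subgroup.topEquiv.toMonoidHom, ?_, ?_, ?_⟩
  · exact Subgroup.Normal.map inferInstance _ Subgroup.topEquiv.surjective
  · exact ⟨by
      rw [MulEquiv.toMonoidHom_eq_coe, Subgroup.index_map_equiv]
      exact Subgroup.FiniteIndex.index_ne_zero⟩
  · rintro x ⟨y, hy, hyx⟩
    obtain rfl : y = x := Subtype.ext hyx
    exact hy

/-- A group isomorphic to a group presented by finitely many generators and relators. -/
theorem FinitelyPresentedGroup.of_mulEquiv {G H : Type*} [Group G] [Group H]
    (h : FinitelyPresentedGroup G) (e : G ≃* H) : FinitelyPresentedGroup H := by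
  obtain ⟨k, R, ⟨f⟩⟩ := h
  exact ⟨k, R, ⟨f.trans e⟩⟩

theorem finitelyPresentedGroup_freeGroup (N : Type*) [Finite N] :
    FinitelyPresentedGroup (FreeGroup N) := by
  obtain ⟨k, ⟨e⟩⟩ := Finite.exists_equiv_fin N
  refine ⟨k, ∅, ⟨MulEquiv.trans ?_ (FreeGroup.freeGroupCongr e.symm)⟩⟩
  refine (QuotientGroup.quotientMulEquivOfEq ?_).trans QuotientGroup.quotientBot
  simp

section Gadget

variable {X ι Γ : Type} [Group Γ] {rel : ι → FreeGroup X} {w : FreeGroup X}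
  {γ : GadgetVertex X ι ⊕ GadgetIndex X ι → Γ}

/-- Outside the normal closure of the relators, the gadget subgroup is free. -/
noncomputable def gadgetFreeEquiv (hγ : IsRaag (GadgetAdj X ι) γ)
    (hw : w ∉ Subgroup.normalClosure (Set.range rel)) :
    FreeGroup (GadgetGen X ι) ≃* Subgroup.closure (Set.range (gadgetGen rel γ w)) :=
  (MonoidHom.ofInjective (lift_gadgetGen_injective hγ hw)).trans
    (MulEquiv.subgroupCongr FreeGroup.range_lift_eq_closure)

theorem gadgetFreeEquiv_of (hγ : IsRaag (GadgetAdj X ι) γ)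
    (hw : w ∉ Subgroup.normalClosure (Set.range rel)) (n : GadgetGen X ι) :
    gadgetFreeEquiv hγ hw (.of n) =
      ⟨gadgetGen rel γ w n, Subgroup.subset_closure ⟨n, rfl⟩⟩ := by
  ext
  change ((MonoidHom.ofInjective (lift_gadgetGen_injective hγ hw)) (.of n) : Γ) = _
  rw [MonoidHom.ofInjective_apply, FreeGroup.lift_apply_of]

theorem finitelyPresentedGroup_gadget [Finite X] [Finite ι] (hγ : IsRaag (GadgetAdj X ι) γ)
    (hΓ : FinitelyPresentedGroup Γ) :
    FinitelyPresentedGroup (Subgroup.closure (Set.range (gadgetGen rel γ w))) := by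
  by_cases hw : w ∈ Subgroup.normalClosure (Set.range rel)
  · rw [closure_gadgetGen_eq_top hγ hw]
    exact hΓ.of_mulEquiv Subgroup.topEquiv.symm
  · exact (finitelyPresentedGroup_freeGroup _).of_mulEquiv (gadgetFreeEquiv hγ hw)

theorem not_profinite_gadget (hγ : IsRaag (GadgetAdj X ι) γ)
    (hw : w ∉ Subgroup.normalClosure (Set.range rel))
    (hs : ProfiniteSurj (Subgroup.closure (Set.range (gadgetGen rel γ w))))
    (hi : ProfiniteInj (Subgroup.closure (Set.range (gadgetGen rel γ w)))) : False := by
  set P := Subgroup.closure (Set.range (gadgetGen rel γ w))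
  let χ : GadgetGen X ι → Multiplicative (ZMod 2) := fun n => match n with
    | .zeta (.inl false) => Multiplicative.ofAdd 1
    | _ => 1
  let ψ : P →* Multiplicative (ZMod 2) :=
    (FreeGroup.lift χ).comp (gadgetFreeEquiv hγ hw).symm.toMonoidHom
  let σ (n) : P := ⟨gadgetGen rel γ w n, Subgroup.subset_closure ⟨n, rfl⟩⟩
  have hψ (n) : ψ (σ n) = χ n := by
    have : (gadgetFreeEquiv hγ hw).symm (σ n) = .of n := by
      rw [MulEquiv.symm_apply_eq, gadgetFreeEquiv_of]
    change FreeGroup.lift χ ((gadgetFreeEquiv hγ hw).symm (σ n)) = _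
    rw [this, FreeGroup.lift_apply_of]
  obtain ⟨L, hL, hL', hLψ⟩ := hi ψ.ker inferInstance inferInstance
  have hsurj := hs (Γ ⧸ L) (QuotientGroup.mk' L) (QuotientGroup.mk'_surjective L)
  obtain ⟨p, hp⟩ := hsurj (QuotientGroup.mk' L (gadgetCommutator γ))
  obtain ⟨q, hq⟩ := hsurj (QuotientGroup.mk' L (γ (.inl (.l 2))))
  have key (b : Bool) : ψ (σ (.zeta (.inl b))) = ψ p * ψ (σ (.s (.inl b))) * ψ q := by
    rw [← map_mul, ← map_mul, ← inv_mul_eq_one, ← map_inv, ← map_mul]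
    refine hLψ ?_
    rw [Subgroup.mem_subgroupOf, Subgroup.coe_mul, Subgroup.coe_inv, ← QuotientGroup.eq]
    change QuotientGroup.mk' L _ = QuotientGroup.mk' L _
    have h1 : (σ (.zeta (.inl b)) : Γ) =
        gadgetCommutator γ * γ (.inr (.inl b)) * γ (.inl (.l 2)) := by
      simp [σ, gadgetGen]
    have hp' : QuotientGroup.mk' L (p : Γ) = _ := hp
    have hq' : QuotientGroup.mk' L (q : Γ) = _ := hq
    rw [Subgroup.coe_mul, Subgroup.coe_mul, map_mul, map_mul, h1, map_mul, map_mul, hp', hq']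
    rfl
  have h0 := key false
  have h1 := key true
  rw [hψ, hψ] at h0 h1
  simp only [χ, mul_one] at h0 h1
  rw [← h1] at h0
  exact absurd h0 (by decide)

theorem profinite_gadget_iff (hγ : IsRaag (GadgetAdj X ι) γ) :
    (ProfiniteSurj (Subgroup.closure (Set.range (gadgetGen rel γ w))) ∧
      ProfiniteInj (Subgroup.closure (Set.range (gadgetGen rel γ w)))) ↔
      w ∈ Subgroup.normalClosure (Set.range rel) := by
  refine ⟨fun h => by_contra fun hw => not_profinite_gadget hγ hw h.1 h.2, fun hw => ?_⟩
  rw [closure_gadgetGen_eq_top hγ hw]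
  exact ⟨profiniteSurj_top Γ, profiniteInj_top Γ⟩

end Gadget

section Transport

variable {q k : ℕ} {ι : Type} (e : GadgetVertex (Fin q) ι ⊕ GadgetIndex (Fin q) ι ≃ Fin k)

/-- The word of the generator of the gadget subgroup that depends on the word `u`. -/
def gadgetAlphaWord (u : List (Fin q × Bool)) : List (Fin k × Bool) :=
  FreeGroup.invRev (u.map fun p => (e (.inl (.xr p.1)), p.2)) ++ [(e (.inl .a), true)] ++
    (u.map fun p => (e (.inl (.xr p.1)), p.2)) ++ [(e (.inl (.l 0)), true)]

theorem mk_gadgetAlphaWord (rel : ι → FreeGroup (Fin q)) (u : List (Fin q × Bool)) :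
    FreeGroup.mk (gadgetAlphaWord e u) =
      gadgetGen rel (fun v => FreeGroup.of (e v)) (FreeGroup.mk u) .alpha := by
  have h : gadgetRight (fun v => FreeGroup.of (e v)) (FreeGroup.mk u) =
      FreeGroup.mk (u.map fun p => (e (.inl (.xr p.1)), p.2)) := by
    refine Eq.trans ?_ (FreeGroup.map.mk (f := fun x => e (.inl (.xr x))))
    rw [FreeGroup.map_eq_lift]
    rfl
  rw [gadgetGen, h]
  simp only [gadgetAlphaWord, ← FreeGroup.mul_mk, ← FreeGroup.inv_mk]
  rfl

theorem primrec_gadgetAlphaWord : Primrec (gadgetAlphaWord e) := by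
  have h : Primrec fun u : List (Fin q × Bool) =>
      u.map fun p => (e (.inl (.xr p.1)), p.2) :=
    Primrec.list_map Primrec.id ((Primrec.dom_finite fun p : Fin q × Bool =>
      (e (.inl (.xr p.1)), p.2)).comp Primrec.snd).to₂
  have h' : Primrec fun u : List (Fin k × Bool) => FreeGroup.invRev u :=
    Primrec.list_reverse.comp (Primrec.list_map Primrec.id ((Primrec.dom_finite
      fun p : Fin k × Bool => (p.1, !p.2)).comp Primrec.snd).to₂)
  exact Primrec.list_append.comp (Primrec.list_append.comp (Primrec.list_append.comp
    (h'.comp h) (Primrec.const _)) h) (Primrec.const _)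

/-- A homomorphism to the integers separating the generator that depends on a word from the
other generators. -/
theorem gadgetGen_alpha_ne (rel : ι → FreeGroup (Fin q)) (u u' : FreeGroup (Fin q))
    {n : GadgetGen (Fin q) ι} (hn : n ≠ .alpha) :
    gadgetGen rel (fun v => FreeGroup.of (e v)) u .alpha ≠
      gadgetGen rel (fun v => FreeGroup.of (e v)) u' n := by
  let χ : GadgetVertex (Fin q) ι → Multiplicative ℤ := fun v => match v with
    | .y _ => Multiplicative.ofAdd 1
    | .d => Multiplicative.ofAdd 1
    | _ => 1
  let c : GadgetVertex (Fin q) ι ⊕ GadgetIndex (Fin q) ι → Multiplicative ℤ :=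
    Sum.elim χ fun _ => Multiplicative.ofAdd 1
  intro h
  have := congrArg (FreeGroup.lift fun i => c (e.symm i)) h
  have hr : gadgetRight c = 1 := by ext; simp [c, χ]
  have hc : gadgetCommutator c = 1 := by simp [gadgetCommutator, c, χ]
  rw [map_gadgetGen, map_gadgetGen] at this
  simp only [FreeGroup.lift_apply_of, Equiv.symm_apply_apply] at this
  change gadgetGen rel c _ _ = gadgetGen rel c _ _ at this
  rcases n with (x | r) | _ | _ | j | (j | j)
  case alpha => exact hn rfl
  all_goals simp only [gadgetGen, hr, hc] at this
  case zeta.inr => cases j <;> simp [c, χ] at this <;> exact absurd this (by decide)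
  all_goals simp [c, χ] at this; exact absurd this (by decide)

open Classical in
/-- The words of the commutation relations of the gadget graph. -/
noncomputable def gadgetRelators : List (List (Fin k × Bool)) :=
  (Finset.univ.filter fun p : Fin k × Fin k =>
    GadgetAdj (Fin q) ι (e.symm p.1) (e.symm p.2)).toList.map fun p =>
      [(p.1, true), (p.2, true), (p.1, false), (p.2, false)]

theorem isRaag_gadgetRelators : IsRaag (GadgetAdj (Fin q) ι) fun v =>
    (PresentedGroup.of (e v) : wordPresentedGroup k (gadgetRelators e)) where
  closure_range := by
    rw [← PresentedGroup.closure_range_of]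
    congr 1
    exact (EquivLike.surjective e).range_comp
      (PresentedGroup.of (rels := FreeGroup.mk '' {w | w ∈ gadgetRelators e}))
  commute u v h := by
    rw [commute_iff_eq, ← mul_inv_eq_one, mul_inv_rev, ← mul_assoc]
    refine PresentedGroup.one_of_mem (x := FreeGroup.mk _)
      ⟨[(e u, true), (e v, true), (e u, false), (e v, false)], ?_, rfl⟩
    simp only [gadgetRelators, Set.mem_ofPred_eq, List.mem_map, Finset.mem_toList, Finset.mem_filter]
    exact ⟨(e u, e v), by simpa using h, rfl⟩
  exists_lift K _ f hf := by
    refine ⟨PresentedGroup.toGroup (f := fun i => f (e.symm i)) ?_, fun v => ?_⟩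
    · rintro _ ⟨w, hw, rfl⟩
      simp only [gadgetRelators, Set.mem_ofPred_eq, List.mem_map, Finset.mem_toList,
        Finset.mem_filter] at hw
      obtain ⟨p, hp, rfl⟩ := hw
      have := (hf _ _ hp.2).eq
      simp [FreeGroup.lift_mk, ← mul_assoc, this]
    · simp

theorem finitelyPresentedGroup_wordPresentedGroup (R : List (List (Fin k × Bool))) :
    FinitelyPresentedGroup (wordPresentedGroup k R) := by
  classical
  refine ⟨k, R.toFinset.image FreeGroup.mk, ?_⟩
  have : ((R.toFinset.image FreeGroup.mk : Finset (FreeGroup (Fin k))) : Set _) =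
      FreeGroup.mk '' {w | w ∈ R} := by ext; simp
  rw [this]
  exact ⟨MulEquiv.refl _⟩

open Classical in
/-- The words of the generators of the gadget subgroup that do not depend on a word. -/
noncomputable def gadgetConstWords [Finite ι] (rel : ι → FreeGroup (Fin q)) :
    List (List (Fin k × Bool)) :=
  ((Set.toFinite {n : GadgetGen (Fin q) ι | n ≠ .alpha}).toFinset).toList.map fun n =>
    (gadgetGen rel (fun v => FreeGroup.of (e v)) 1 n).toWord

theorem wordSubgroup_gadget [Finite ι] (rel : ι → FreeGroup (Fin q))
    (R : List (List (Fin k × Bool))) (u : List (Fin q × Bool)) :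
    wordSubgroup k R (gadgetAlphaWord e u :: gadgetConstWords e rel) =
      Subgroup.closure (Set.range (gadgetGen rel (fun v =>
        (PresentedGroup.of (e v) : wordPresentedGroup k R)) (FreeGroup.mk u))) := by
  have hm (u n) : PresentedGroup.mk (FreeGroup.mk '' {w | w ∈ R})
      (gadgetGen rel (fun v => FreeGroup.of (e v)) u n) = gadgetGen rel (fun v =>
        (PresentedGroup.of (e v) : wordPresentedGroup k R)) u n := map_gadgetGen _ _ _ _ _
  have hc {n : GadgetGen (Fin q) ι} (hn : n ≠ .alpha) (u u') : gadgetGen rel (fun v =>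
      (PresentedGroup.of (e v) : wordPresentedGroup k R)) u n = gadgetGen rel (fun v =>
      (PresentedGroup.of (e v) : wordPresentedGroup k R)) u' n := by
    rcases n with (x | r) | _ | _ | j | (j | j)
    all_goals first | rfl | exact (hn rfl).elim
  unfold wordSubgroup
  congr 1
  ext g
  simp only [Set.mem_image, Set.mem_ofPred_eq, List.mem_cons, gadgetConstWords, List.mem_map,
    Finset.mem_toList, Set.Finite.mem_toFinset, Set.mem_range]
  constructor
  · rintro ⟨v, rfl | ⟨n, hn, rfl⟩, rfl⟩
    · exact ⟨.alpha, by rw [mk_gadgetAlphaWord e rel, hm]⟩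
    · exact ⟨n, by rw [FreeGroup.mk_toWord, hm, hc hn]⟩
  · rintro ⟨n, rfl⟩
    by_cases hn : n = .alpha
    · subst hn
      exact ⟨_, .inl rfl, by rw [mk_gadgetAlphaWord e rel, hm]⟩
    · exact ⟨_, .inr ⟨n, hn, rfl⟩, by rw [FreeGroup.mk_toWord, hm, hc hn]⟩

theorem card_gadgetWords [Finite ι] (rel : ι → FreeGroup (Fin q)) (u : List (Fin q × Bool)) :
    (gadgetAlphaWord e u :: gadgetConstWords e rel).toFinset.card =
      (gadgetConstWords e rel).toFinset.card + 1 := by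
  rw [List.toFinset_cons, Finset.card_insert_of_notMem]
  simp only [List.mem_toFinset, gadgetConstWords, List.mem_map, Finset.mem_toList,
    Set.Finite.mem_toFinset, Set.mem_ofPred_eq]
  rintro ⟨n, hn, h⟩
  refine gadgetGen_alpha_ne e rel (FreeGroup.mk u) 1 hn ?_
  rw [← mk_gadgetAlphaWord, ← h, FreeGroup.mk_toWord]

end Transport

/-- A finite presentation with an undecidable word problem gives a sequence of subgroups of
residually finite groups with an undecidable profinite isomorphism problem. -/
theorem exists_profinite_sequence_of_word_problem {q : ℕ} {ι : Type} [Finite ι]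
    (rel : ι → FreeGroup (Fin q)) (w : ℕ → List (Fin q × Bool)) (hw : Computable w)
    (hund : ¬ ∃ f : ℕ → Bool, Computable f ∧
      ∀ n, f n = true ↔ FreeGroup.mk (w n) ∈ Subgroup.normalClosure (Set.range rel)) :
    ∃ (k cR cS : ℕ) (R S : ℕ → List (List (Fin k × Bool))),
      Computable R ∧ Computable S ∧
      (∀ n, (R n).toFinset.card = cR) ∧ (∀ n, (S n).toFinset.card = cS) ∧
      (∀ n, ResiduallyFinite (wordPresentedGroup k (R n))) ∧
      (∀ n, FinitelyPresentedGroup ↥(wordSubgroup k (R n) (S n))) ∧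
      ¬ ∃ f : ℕ → Bool, Computable f ∧
          ∀ n, f n = true ↔
            (ProfiniteSurj (wordSubgroup k (R n) (S n)) ∧
              ProfiniteInj (wordSubgroup k (R n) (S n))) := by
  obtain ⟨k, ⟨e⟩⟩ := Finite.exists_equiv_fin (GadgetVertex (Fin q) ι ⊕ GadgetIndex (Fin q) ι)
  have hγ := isRaag_gadgetRelators e
  refine ⟨k, _, _, fun _ => gadgetRelators e,
    fun n => gadgetAlphaWord e (w n) :: gadgetConstWords e rel, Computable.const _,
    Computable.list_cons.comp ((primrec_gadgetAlphaWord e).to_comp.comp hw) (Computable.const _),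
    fun n => rfl, fun n => card_gadgetWords e rel _, fun n => hγ.detect, fun n => ?_, ?_⟩
  · rw [wordSubgroup_gadget]
    exact finitelyPresentedGroup_gadget hγ (finitelyPresentedGroup_wordPresentedGroup _)
  · rintro ⟨f, hf, h⟩
    refine hund ⟨f, hf, fun n => ?_⟩
    rw [h n, wordSubgroup_gadget, profinite_gadget_iff hγ]

/-- Two maps with large fibres differ by a bijection, which may be prescribed at a point. -/
theorem exists_equiv_prod_of_surjective {A A' M Z : Type} [Infinite M] (c : A → Z) (c' : A' → Z)
    (hc : Function.Surjective c) (hc' : Function.Surjective c') (i : A ↪ M) (i' : A' ↪ M)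
    (a₀ : A) (a₀' : A') (m₀ : M) (h₀ : c a₀ = c' a₀') :
    ∃ f : A × M ≃ A' × M, (∀ n, c' (f n).1 = c n.1) ∧ f (a₀, m₀) = (a₀', m₀) := by
  classical
  have key {B : Type} (c : B → Z) (hc : Function.Surjective c) (i : B ↪ M) (z : Z) :
      Nonempty ({n : B × M // c n.1 = z} ≃ M) := by
    have e : {n : B × M // c n.1 = z} ≃ {b : B // c b = z} × M :=
      { toFun := fun n => (⟨n.1.1, n.2⟩, n.1.2)
        invFun := fun n => ⟨(n.1.1, n.2), n.1.2⟩
        left_inv := fun _ => rfl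
        right_inv := fun _ => rfl }
    obtain ⟨b, hb⟩ := hc z
    have : Nonempty {b : B // c b = z} := ⟨⟨b, hb⟩⟩
    rw [← Cardinal.eq, Cardinal.mk_congr e, Cardinal.mk_prod, Cardinal.lift_id, Cardinal.lift_id]
    exact Cardinal.mul_eq_right (Cardinal.aleph0_le_mk M)
      (Cardinal.mk_le_of_injective (i.injective.comp Subtype.val_injective))
      (Cardinal.mk_ne_zero _)
  let g : A × M ≃ A' × M := Equiv.ofFiberEquiv (f := fun n => c n.1) (g := fun n => c' n.1)
    fun z => (key c hc i z).some.trans (key c' hc' i' z).some.symm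
  have hg (n) : c' (g n).1 = c n.1 :=
    Equiv.ofFiberEquiv_map (f := fun n : A × M => c n.1) (g := fun n : A' × M => c' n.1) _ n
  refine ⟨g.trans (Equiv.swap (g (a₀, m₀)) (a₀', m₀)), fun n => ?_, by simp⟩
  rw [Equiv.trans_apply, Equiv.swap_apply_def]
  split_ifs with h1 h2
  · rw [← hg, h1, hg, h₀]
  · rw [← hg n, h2, hg, h₀]
  · exact hg n

section ShiftModel

variable {κ : Type}

/-- The points of the permutation model. -/
abbrev ShiftPoint (κ : Type) : Type :=
  Set (κ → ℤ) × (Set (κ → ℤ) × (κ → ℤ) × ℕ) × (κ → ℤ) × Bool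

/-- The translations of the permutation model. -/
def shiftHom (κ : Type) : Multiplicative (κ → ℤ) →* Equiv.Perm (ShiftPoint κ) where
  toFun P := (Equiv.refl _).prodCongr ((Equiv.refl _).prodCongr
    ((Equiv.addRight P.toAdd).prodCongr (.refl _)))
  map_one' := by ext1 t; simp
  map_mul' P Q := by ext1 t; simp [Prod.map, add_comm, add_left_comm]

open Classical in
/-- The flip of the permutation model: it flips the last coordinate outside of the set. -/
noncomputable def shiftFlip (κ : Type) : Equiv.Perm (ShiftPoint κ) :=
  Function.Involutive.toPerm
    (fun t => (t.1, t.2.1, t.2.2.1, xor t.2.2.2 (decide (t.2.2.1 ∉ t.1)))) fun t => by simp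

/-- The conjugate of the flip by a translation. -/
noncomputable def shiftFlipAt (P : κ → ℤ) : Equiv.Perm (ShiftPoint κ) :=
  (shiftHom κ (.ofAdd P))⁻¹ * shiftFlip κ * shiftHom κ (.ofAdd P)

open Classical in
theorem shiftFlipAt_apply (P : κ → ℤ) (t : ShiftPoint κ) : shiftFlipAt P t =
    (t.1, t.2.1, t.2.2.1, xor t.2.2.2 (decide (P + t.2.2.1 ∉ t.1))) := by
  rw [shiftFlipAt, ← map_inv]
  simp only [Equiv.Perm.mul_apply]
  simp [shiftHom, shiftFlip, Prod.map, add_comm]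

/-- Residues modulo a family of integers. -/
abbrev Residues (D : κ → ℤ) : Type := {v : κ → ℤ // ∀ i, v i % D i = v i}

/-- Division with remainder. -/
def residuesEquiv (D : κ → ℤ) (hD : ∀ i, D i ≠ 0) : (κ → ℤ) ≃ Residues D × (κ → ℤ) where
  toFun P := (⟨fun i => P i % D i, fun i => Int.emod_emod_of_dvd _ dvd_rfl⟩, fun i => P i / D i)
  invFun n := n.1.1 + D * n.2
  left_inv P := by ext i; exact Int.emod_add_mul_ediv _ _
  right_inv n := by
    refine Prod.ext (Subtype.ext (funext fun i => ?_)) (funext fun i => ?_)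
    · simp [n.1.2 i]
    · have : n.1.1 i / D i = 0 := by
        have := Int.emod_add_mul_ediv (n.1.1 i) (D i)
        rw [n.1.2 i] at this
        simpa [hD i] using this
      simp [Int.add_mul_ediv_left _ _ (hD i), this]

/-- The orbit decomposition of the permutation model. -/
def shiftDecomp (D : κ → ℤ) (hD : ∀ i, D i ≠ 0) : ShiftPoint κ ≃
    ((Set (κ → ℤ) × Residues D) × (Set (κ → ℤ) × (κ → ℤ) × ℕ)) × (κ → ℤ) × Bool where
  toFun t := (((t.1, (residuesEquiv D hD t.2.2.1).1), t.2.1),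
    (residuesEquiv D hD t.2.2.1).2, t.2.2.2)
  invFun n := (n.1.1.1, n.1.2, (residuesEquiv D hD).symm (n.1.1.2, n.2.1), n.2.2)
  left_inv t := by simp
  right_inv n := by simp

/-- For two rescaled translation lattices there is a permutation intertwining them. -/
theorem exists_perm_intertwining (C : Set (κ → ℤ)) (p D q D' : κ → ℤ)
    (hD : ∀ i, D i ≠ 0) (hD' : ∀ i, D' i ≠ 0) (hC : ∀ u, p + D * u ∈ C ↔ q + D' * u ∈ C) :
    ∃ r : Equiv.Perm (ShiftPoint κ), r (C, (∅, 0, 0), 0, false) = (C, (∅, 0, 0), 0, false) ∧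
      (∀ u, r * shiftHom κ (.ofAdd (D * u)) = shiftHom κ (.ofAdd (D' * u)) * r) ∧
      r * shiftFlipAt p = shiftFlipAt q * r := by
  classical
  let c (p D : κ → ℤ) (n : Set (κ → ℤ) × Residues D) : Set (κ → ℤ) :=
    {u | p + (n.2.1 + D * u) ∈ n.1}
  have hc (p D : κ → ℤ) (hD : ∀ i, D i ≠ 0) : Function.Surjective (c p D) := by
    intro s
    refine ⟨((fun u => p + D * u) '' s, ⟨0, by simp⟩), ?_⟩
    ext u
    simp only [c, zero_add, Set.mem_ofPred_eq]
    refine Function.Injective.mem_set_image ?_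
    intro u u' h
    ext i
    have := congrFun h i
    simpa [hD i] using this
  let emb (D : κ → ℤ) : Set (κ → ℤ) × Residues D ↪ Set (κ → ℤ) × (κ → ℤ) × ℕ :=
    ⟨fun n => (n.1, n.2.1, 0), fun n n' h => by
      simp only [Prod.mk.injEq] at h
      exact Prod.ext h.1 (Subtype.ext h.2.1)⟩
  obtain ⟨f, hf, hf₀⟩ := exists_equiv_prod_of_surjective (c p D) (c q D') (hc p D hD) (hc q D' hD')
    (emb D) (emb D') (C, ⟨0, by simp⟩) (C, ⟨0, by simp⟩) (∅, 0, 0) (by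
      ext u
      simpa [c] using hC u)
  let r : Equiv.Perm (ShiftPoint κ) := (shiftDecomp D hD).trans
    ((f.prodCongr (.refl _)).trans (shiftDecomp D' hD').symm)
  have hr (n u b) : r ((shiftDecomp D hD).symm (n, u, b)) =
      (shiftDecomp D' hD').symm (f n, u, b) := by
    simp [r]
  have hshift (D : κ → ℤ) (hD : ∀ i, D i ≠ 0) (n u b v) :
      shiftHom κ (.ofAdd (D * v)) ((shiftDecomp D hD).symm (n, u, b)) =
        (shiftDecomp D hD).symm (n, u + v, b) := by
    simp [shiftHom, shiftDecomp, residuesEquiv, mul_add, add_assoc]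
  have hflip (p D : κ → ℤ) (hD : ∀ i, D i ≠ 0) (n u b) (s : Set (κ → ℤ))
      (hs : c p D n.1 = s) : shiftFlipAt p ((shiftDecomp D hD).symm (n, u, b)) =
        (shiftDecomp D hD).symm (n, u, xor b (decide (u ∉ s))) := by
    subst hs
    rw [shiftFlipAt_apply]
    rfl
  refine ⟨r, ?_, fun v => ?_, ?_⟩
  · have h (D : κ → ℤ) (hD : ∀ i, D i ≠ 0) : (C, (∅, 0, 0), 0, false) =
        (shiftDecomp D hD).symm (((C, ⟨0, by simp⟩), (∅, 0, 0)), 0, false) := by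
      simp [shiftDecomp, residuesEquiv]
    conv_lhs => rw [h D hD]
    rw [hr, hf₀, ← h]
  · ext1 t
    obtain ⟨⟨n, u, b⟩, rfl⟩ := (shiftDecomp D hD).symm.surjective t
    rw [Equiv.Perm.mul_apply, Equiv.Perm.mul_apply, hshift, hr, hr, hshift]
  · ext1 t
    obtain ⟨⟨n, u, b⟩, rfl⟩ := (shiftDecomp D hD).symm.surjective t
    rw [Equiv.Perm.mul_apply, Equiv.Perm.mul_apply, hflip p D hD n u b _ rfl, hr, hr,
      hflip q D' hD' _ u b _ (hf n)]

end ShiftModel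

section AffineSystem

open scoped commutatorElement

variable {κ ρ : Type} [Fintype κ] {H K : Type*} [Group H] [Group K]

/-- A product of powers of the translation generators. -/
noncomputable def translationAt (φ : κ ⊕ Bool ⊕ ρ → H) (P : κ → ℤ) : H :=
  ((Finset.univ : Finset κ).toList.map fun i => φ (.inl i) ^ P i).prod

/-- The conjugate of the flip generator by a translation. -/
noncomputable def flipAt (φ : κ ⊕ Bool ⊕ ρ → H) (P : κ → ℤ) : H :=
  (translationAt φ P)⁻¹ * φ (.inr (.inl true)) * translationAt φ P

/-- The relators of the group of a finite system of affine rules. -/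
noncomputable def affineRelator (p D q D' : ρ → κ → ℤ) (T : κ → ℤ) (φ : κ ⊕ Bool ⊕ ρ → H) :
    (κ × κ) ⊕ (ρ × κ) ⊕ ρ ⊕ ρ ⊕ Unit → H
  | .inl (i, j) => ⁅φ (.inl i), φ (.inl j)⁆
  | .inr (.inl (r, i)) => φ (.inr (.inr r)) * φ (.inl i) ^ D r i *
      (φ (.inl i) ^ D' r i * φ (.inr (.inr r)))⁻¹
  | .inr (.inr (.inl r)) => φ (.inr (.inr r)) * flipAt φ (p r) *
      (flipAt φ (q r) * φ (.inr (.inr r)))⁻¹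
  | .inr (.inr (.inr (.inl r))) => ⁅φ (.inr (.inl false)), φ (.inr (.inr r))⁆
  | .inr (.inr (.inr (.inr _))) => ⁅φ (.inr (.inl false)), flipAt φ T⁆

theorem map_translationAt (f : H →* K) (φ : κ ⊕ Bool ⊕ ρ → H) (P : κ → ℤ) :
    f (translationAt φ P) = translationAt (fun x => f (φ x)) P := by
  simp [translationAt, map_list_prod, Function.comp_def]

theorem map_flipAt (f : H →* K) (φ : κ ⊕ Bool ⊕ ρ → H) (P : κ → ℤ) :
    f (flipAt φ P) = flipAt (fun x => f (φ x)) P := by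
  simp [flipAt, map_translationAt]

theorem map_affineRelator (f : H →* K) (p D q D' : ρ → κ → ℤ) (T : κ → ℤ)
    (φ : κ ⊕ Bool ⊕ ρ → H) (n) :
    f (affineRelator p D q D' T φ n) = affineRelator p D q D' T (fun x => f (φ x)) n := by
  rcases n with _ | _ | _ | _ | _ <;>
    simp [affineRelator, map_flipAt, map_commutatorElement]

theorem List.prod_map_mul_of_commute {α : Type*} (l : List α) (f g : α → H)
    (h : ∀ i j, Commute (f i) (g j)) :
    (l.map fun i => f i * g i).prod = (l.map f).prod * (l.map g).prod := by
  induction l with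
  | nil => simp
  | cons a l ih =>
    have : Commute (l.map f).prod (g a) := Commute.list_prod_left _ _ (by
      simp only [List.mem_map, forall_exists_index, and_imp, forall_apply_eq_imp_iff₂]
      exact fun i _ => h i a)
    simp only [List.map_cons, List.prod_cons, ih, mul_assoc]
    rw [← mul_assoc (g a), ← this.eq, mul_assoc]

/-- In a group satisfying the relations of an affine system, the flips at the points of the
generated set commute with the distinguished generator. -/
theorem commute_flipAt_of_mem {p D q D' : ρ → κ → ℤ} {T : κ → ℤ} {φ : κ ⊕ Bool ⊕ ρ → H}
    (hφ : ∀ n, affineRelator p D q D' T φ n = 1) {C : Set (κ → ℤ)}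
    (hmin : ∀ G : Set (κ → ℤ), T ∈ G →
      (∀ r u, p r + D r * u ∈ G ↔ q r + D' r * u ∈ G) → C ⊆ G) {P : κ → ℤ} (hP : P ∈ C) :
    Commute (φ (.inr (.inl false))) (flipAt φ P) := by
  have hadd (P Q : κ → ℤ) : translationAt φ (P + Q) = translationAt φ P * translationAt φ Q := by
    simp only [translationAt, Pi.add_apply, zpow_add]
    refine List.prod_map_mul_of_commute _ _ _ fun i j => Commute.zpow_zpow ?_ _ _
    exact commutatorElement_eq_one_iff_commute.1 (hφ (.inl (i, j)))
  have hflip (P Q : κ → ℤ) : flipAt φ (P + Q) =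
      (translationAt φ Q)⁻¹ * flipAt φ P * translationAt φ Q := by
    simp [flipAt, hadd, mul_assoc]
  have hx (r u) : SemiconjBy (φ (.inr (.inr r))) (translationAt φ (D r * u))
      (translationAt φ (D' r * u)) := by
    have h (i) : SemiconjBy (φ (.inr (.inr r))) (φ (.inl i) ^ (D r * u) i)
        (φ (.inl i) ^ (D' r * u) i) := by
      have : SemiconjBy (φ (.inr (.inr r))) (φ (.inl i) ^ D r i) (φ (.inl i) ^ D' r i) :=
        mul_inv_eq_one.1 (hφ (.inr (.inl (r, i))))
      simpa [zpow_mul] using this.zpow_right (u i)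
    unfold translationAt
    induction (Finset.univ : Finset κ).toList with
    | nil => simp
    | cons a l ih => simpa using (h a).mul_right ih
  have ht (r u) : SemiconjBy (φ (.inr (.inr r))) (flipAt φ (p r + D r * u))
      (flipAt φ (q r + D' r * u)) := by
    rw [hflip, hflip]
    exact ((hx r u).inv_right.mul_right (mul_inv_eq_one.1 (hφ (.inr (.inr (.inl r)))))).mul_right
      (hx r u)
  have hk (r) : Commute (φ (.inr (.inl false))) (φ (.inr (.inr r))) :=
    commutatorElement_eq_one_iff_commute.1 (hφ (.inr (.inr (.inr (.inl r)))))
  refine hmin {P | Commute (φ (.inr (.inl false))) (flipAt φ P)}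
    (commutatorElement_eq_one_iff_commute.1 (hφ (.inr (.inr (.inr (.inr ())))))) (fun r u => ?_) hP
  simp only [Set.mem_ofPred_eq]
  constructor <;> intro h
  · have := ht r u
    rw [show flipAt φ (q r + D' r * u) = φ (.inr (.inr r)) * flipAt φ (p r + D r * u) *
      (φ (.inr (.inr r)))⁻¹ by rw [this.eq]; simp]
    exact ((hk r).mul_right h).mul_right (hk r).inv_right
  · have := ht r u
    rw [show flipAt φ (p r + D r * u) = (φ (.inr (.inr r)))⁻¹ * flipAt φ (q r + D' r * u) *
      φ (.inr (.inr r)) by rw [mul_assoc, ← this.eq]; simp]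
    exact ((hk r).inv_right.mul_right h).mul_right (hk r)

/-- The group of an affine system has a permutation representation detecting the complement of
an invariant set. -/
theorem exists_perm_representation {p D q D' : ρ → κ → ℤ} {T : κ → ℤ}
    (hD : ∀ r i, D r i ≠ 0) (hD' : ∀ r i, D' r i ≠ 0) {C : Set (κ → ℤ)} (hT : T ∈ C)
    (hC : ∀ r u, p r + D r * u ∈ C ↔ q r + D' r * u ∈ C) :
    ∃ (K : Type) (_ : Group K) (φ : κ ⊕ Bool ⊕ ρ → K),
      (∀ n, affineRelator p D q D' T φ n = 1) ∧
      ∀ P, Commute (φ (.inr (.inl false))) (flipAt φ P) → P ∈ C := by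
  classical
  choose R hR₀ hRx hRt using fun r =>
    exists_perm_intertwining C (p r) (D r) (q r) (D' r) (hD r) (hD' r) (hC r)
  let pt : ShiftPoint κ := (C, (∅, 0, 0), 0, false)
  let s : Equiv.Perm (ShiftPoint κ) →* Equiv.Perm (ShiftPoint κ ⊕ Unit) :=
    (Equiv.Perm.sumCongrHom _ _).comp (MonoidHom.inl _ _)
  have hs (g t) : s g (.inl t) = .inl (g t) := rfl
  have hs' (g t) : s g (.inr t) = .inr t := rfl
  let φ : κ ⊕ Bool ⊕ ρ → Equiv.Perm (ShiftPoint κ ⊕ Unit) := Sum.elim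
    (fun i => s (shiftHom κ (.ofAdd (Pi.single i 1)))) (Sum.elim
      (fun b => if b then s (shiftFlip κ) else Equiv.swap (.inl pt) (.inr ())) fun r => s (R r))
  have hx (P : κ → ℤ) : translationAt φ P = s (shiftHom κ (.ofAdd P)) := by
    have : P = ∑ i, P i • Pi.single (M := fun _ => ℤ) i (1 : ℤ) := by
      conv_lhs => rw [← Finset.univ_sum_single P]
      refine Finset.sum_congr rfl fun i _ => ?_
      rw [← Pi.single_smul]
      simp
    conv_rhs => rw [this]
    rw [← Finset.sum_map_toList, ofAdd_list_prod]
    simp only [translationAt, map_list_prod, List.map_map, Function.comp_def, φ, ofAdd_zsmul,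
      map_zpow, Sum.elim_inl]
  have ht (P : κ → ℤ) : flipAt φ P = s (shiftFlipAt P) := by
    simp [flipAt, hx, shiftFlipAt, φ]
  have hk (g : Equiv.Perm (ShiftPoint κ)) (hg : g pt = pt) :
      Commute (φ (.inr (.inl false))) (s g) := by
    have : s g * Equiv.swap (.inl pt) (.inr ()) =
        Equiv.swap (s g (.inl pt)) (s g (.inr ())) * s g := Equiv.mul_swap_eq_swap_mul _ _ _
    rw [hs, hs', hg] at this
    exact this.symm
  have hfix (P : κ → ℤ) : shiftFlipAt P pt = pt ↔ P ∈ C := by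
    rw [shiftFlipAt_apply]
    simp [pt]
  refine ⟨_, inferInstance, φ, ?_, fun P hP => ?_⟩
  · rintro (⟨i, j⟩ | ⟨r, i⟩ | r | r | _) <;> simp only [affineRelator]
    · rw [commutatorElement_eq_one_iff_commute]
      exact ((Commute.all _ _).map (shiftHom κ)).map s
    · rw [mul_inv_eq_one]
      have (E : κ → ℤ) : φ (.inl i) ^ E i = s (shiftHom κ (.ofAdd (E * Pi.single i 1))) := by
        have h : E * Pi.single i 1 = E i • Pi.single (M := fun _ => ℤ) i (1 : ℤ) := by
          ext j
          by_cases hj : j = i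
          · subst hj; simp
          · simp [hj]
        rw [h, ofAdd_zsmul, map_zpow, map_zpow]
        rfl
      rw [this, this]
      simpa [φ] using congrArg s (hRx r (Pi.single i 1))
    · rw [mul_inv_eq_one, ht, ht]
      simpa [φ] using congrArg s (hRt r)
    · rw [commutatorElement_eq_one_iff_commute]
      exact hk _ (hR₀ r)
    · rw [commutatorElement_eq_one_iff_commute, ht]
      exact hk _ ((hfix T).2 hT)
  · rw [ht] at hP
    have := congrArg (fun g : Equiv.Perm _ => g (.inr ())) hP.eq
    simp only [Equiv.Perm.mul_apply, hs', φ, Sum.elim_inr, Sum.elim_inl, Bool.false_eq_true,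
      if_false, Equiv.swap_apply_right, hs, Sum.inl.injEq] at this
    exact (hfix P).1 this.symm

/-- The word of a product of powers. -/
noncomputable def translationWord {X : Type} (x : κ → X) (P : κ → ℕ) : List (X × Bool) :=
  (Finset.univ : Finset κ).toList.flatMap fun i => List.replicate (P i) (x i, true)

theorem computable_translationWord {X : Type} [Primcodable X] (x : κ → X) {enc : ℕ → κ → ℕ}
    (henc : ∀ i, Computable fun n => enc n i) :
    Computable fun n => translationWord x (enc n) := by
  unfold translationWord
  have h (i) : Computable fun n => List.replicate (enc n i) (x i, true) := by
    have : Primrec fun m : ℕ => (List.range m).map fun _ => (x i, true) :=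
      Primrec.list_map Primrec.list_range (Primrec.const _).to₂
    refine (this.to_comp.comp (henc i)).of_eq fun n => ?_
    simp
  induction (Finset.univ : Finset κ).toList with
  | nil => exact Computable.const _
  | cons a l ih => exact Primrec.list_append.to_comp.comp (h a) ih

theorem mk_translationWord {X : Type} (e : κ ⊕ Bool ⊕ ρ → X) (P : κ → ℕ) :
    FreeGroup.mk (translationWord (fun i => e (.inl i)) P) =
      translationAt (fun x => FreeGroup.of (e x)) fun i => P i := by
  unfold translationWord translationAt
  have h (x : X) (m : ℕ) : FreeGroup.mk (List.replicate m (x, true)) = FreeGroup.of x ^ m := by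
    induction m with
    | zero => rfl
    | succ m ih =>
      rw [pow_succ', ← ih, FreeGroup.of, FreeGroup.mul_mk]
      rfl
  induction (Finset.univ : Finset κ).toList with
  | nil => rfl
  | cons a l ih =>
    rw [List.flatMap_cons, ← FreeGroup.mul_mk, ih, h]
    simp

/-- An affine system with an undecidable invariant set gives a sequence of subgroups of
residually finite groups with an undecidable profinite isomorphism problem. -/
theorem exists_profinite_sequence_of_affine_system [Finite ρ] {p D q D' : ρ → κ → ℤ} {T : κ → ℤ}
    (hD : ∀ r i, D r i ≠ 0) (hD' : ∀ r i, D' r i ≠ 0) {C : Set (κ → ℤ)} (hT : T ∈ C)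
    (hC : ∀ r u, p r + D r * u ∈ C ↔ q r + D' r * u ∈ C)
    (hmin : ∀ G : Set (κ → ℤ), T ∈ G →
      (∀ r u, p r + D r * u ∈ G ↔ q r + D' r * u ∈ G) → C ⊆ G)
    {enc : ℕ → κ → ℕ} (henc : ∀ i, Computable fun n => enc n i)
    (hund : ¬ ∃ f : ℕ → Bool, Computable f ∧ ∀ n, f n = true ↔ (fun i => (enc n i : ℤ)) ∈ C) :
    ∃ (k cR cS : ℕ) (R S : ℕ → List (List (Fin k × Bool))),
      Computable R ∧ Computable S ∧
      (∀ n, (R n).toFinset.card = cR) ∧ (∀ n, (S n).toFinset.card = cS) ∧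
      (∀ n, ResiduallyFinite (wordPresentedGroup k (R n))) ∧
      (∀ n, FinitelyPresentedGroup ↥(wordSubgroup k (R n) (S n))) ∧
      ¬ ∃ f : ℕ → Bool, Computable f ∧
          ∀ n, f n = true ↔
            (ProfiniteSurj (wordSubgroup k (R n) (S n)) ∧
              ProfiniteInj (wordSubgroup k (R n) (S n))) := by
  obtain ⟨m, ⟨e⟩⟩ := Finite.exists_equiv_fin (κ ⊕ Bool ⊕ ρ)
  let xw (n : ℕ) : List (Fin m × Bool) := translationWord (fun i => e (.inl i)) (enc n)
  let tw (n : ℕ) : List (Fin m × Bool) :=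
    FreeGroup.invRev (xw n) ++ [(e (.inr (.inl true)), true)] ++ xw n
  let w (n : ℕ) : List (Fin m × Bool) := [(e (.inr (.inl false)), true)] ++ tw n ++
    [(e (.inr (.inl false)), false)] ++ FreeGroup.invRev (tw n)
  let φ : κ ⊕ Bool ⊕ ρ → FreeGroup (Fin m) := fun x => FreeGroup.of (e x)
  have hinv : Computable fun u : List (Fin m × Bool) => FreeGroup.invRev u :=
    (Primrec.list_reverse.comp (Primrec.list_map Primrec.id ((Primrec.dom_finite
      fun p : Fin m × Bool => (p.1, !p.2)).comp Primrec.snd).to₂)).to_comp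
  have happ : Computable₂ fun u v : List (Fin m × Bool) => u ++ v := Primrec.list_append.to_comp
  have hxw : Computable xw := computable_translationWord _ henc
  have htw : Computable tw := happ.comp (happ.comp (hinv.comp hxw) (Computable.const _)) hxw
  have hw : Computable w := happ.comp
    (happ.comp (happ.comp (Computable.const _) htw) (Computable.const _)) (hinv.comp htw)
  have hmk (n) : FreeGroup.mk (w n) = ⁅φ (.inr (.inl false)), flipAt φ fun i => enc n i⁆ := by
    have hx : FreeGroup.mk (xw n) = translationAt φ fun i => enc n i := mk_translationWord e _
    have ht : FreeGroup.mk (tw n) = flipAt φ fun i => enc n i := by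
      simp only [tw, ← FreeGroup.mul_mk, ← FreeGroup.inv_mk, hx]
      rfl
    simp only [w, ← FreeGroup.mul_mk, ← FreeGroup.inv_mk, ht]
    rfl
  refine exists_profinite_sequence_of_word_problem (affineRelator p D q D' T φ) w hw ?_
  rintro ⟨f, hf, h⟩
  refine hund ⟨f, hf, fun n => ?_⟩
  rw [h n, hmk]
  constructor
  · intro hn
    obtain ⟨K, _, ψ, hψ, hψC⟩ := exists_perm_representation hD hD' hT hC
    refine hψC _ ?_
    let F : FreeGroup (Fin m) →* K := FreeGroup.lift fun i => ψ (e.symm i)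
    have hF : (fun x => F (φ x)) = ψ := by ext x; simp [F, φ]
    have hle : Subgroup.normalClosure (Set.range (affineRelator p D q D' T φ)) ≤ F.ker := by
      refine Subgroup.normalClosure_le_normal ?_
      rintro _ ⟨i, rfl⟩
      rw [SetLike.mem_coe, MonoidHom.mem_ker, map_affineRelator, hF, hψ]
    have := hle hn
    rw [MonoidHom.mem_ker, map_commutatorElement, map_flipAt, hF,
      commutatorElement_eq_one_iff_commute] at this
    rw [← hF] at this ⊢
    exact this
  · intro hn
    let N := Subgroup.normalClosure (Set.range (affineRelator p D q D' T φ))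
    rw [← QuotientGroup.eq_one_iff, ← QuotientGroup.mk'_apply, map_commutatorElement, map_flipAt,
      commutatorElement_eq_one_iff_commute]
    refine commute_flipAt_of_mem (p := p) (D := D) (q := q) (D' := D') (T := T)
      (φ := fun x => QuotientGroup.mk' N (φ x)) (fun i => ?_) hmin hn
    rw [← map_affineRelator, QuotientGroup.mk'_apply, QuotientGroup.eq_one_iff]
    exact Subgroup.subset_normalClosure ⟨i, rfl⟩

end AffineSystem

section StackMachine

variable {Λ κ : Type} [DecidableEq κ]

/-- One step of a machine whose stacks are integers in base five: the last digit `d` of the stack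
examined by the control state is replaced by an affine function of the other digits. -/
def affineStep (stack : Λ → κ) (next : Λ → ℤ → Λ) (a b : Λ → ℤ → ℤ) (s : Λ × (κ → ℤ)) :
    Λ × (κ → ℤ) :=
  (next s.1 (s.2 (stack s.1) % 5), Function.update s.2 (stack s.1)
    (a s.1 (s.2 (stack s.1) % 5) + b s.1 (s.2 (stack s.1) % 5) * (s.2 (stack s.1) / 5)))

/-- An undecidable halting problem for a finite stack machine gives a sequence of subgroups of
residually finite groups with an undecidable profinite isomorphism problem. -/
theorem exists_profinite_sequence_of_stack_machine [Finite Λ] [Fintype κ] (stack : Λ → κ)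
    (next : Λ → ℤ → Λ) (a b : Λ → ℤ → ℤ) (hb : ∀ c d, b c d ≠ 0) {T : Λ × (κ → ℤ)}
    (hT : affineStep stack next a b T = T) (c₀ : Λ) {stk : ℕ → κ → ℕ}
    (hstk : ∀ i, Computable fun n => stk n i)
    (hund : ¬ ∃ f : ℕ → Bool, Computable f ∧ ∀ n, f n = true ↔
      ∃ j, (affineStep stack next a b)^[j] (c₀, fun i => stk n i) = T) :
    ∃ (k cR cS : ℕ) (R S : ℕ → List (List (Fin k × Bool))),
      Computable R ∧ Computable S ∧
      (∀ n, (R n).toFinset.card = cR) ∧ (∀ n, (S n).toFinset.card = cS) ∧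
      (∀ n, ResiduallyFinite (wordPresentedGroup k (R n))) ∧
      (∀ n, FinitelyPresentedGroup ↥(wordSubgroup k (R n) (S n))) ∧
      ¬ ∃ f : ℕ → Bool, Computable f ∧
          ∀ n, f n = true ↔
            (ProfiniteSurj (wordSubgroup k (R n) (S n)) ∧
              ProfiniteInj (wordSubgroup k (R n) (S n))) := by
  obtain ⟨m, ⟨e⟩⟩ := Finite.exists_equiv_fin Λ
  have hm : 0 < m := (e c₀).pos
  have hm' : (m : ℤ) ≠ 0 := by exact_mod_cast hm.ne'
  let code (c : Λ) : ℤ := (e c : ℕ)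
  have hcode : Function.Injective code := fun c c' h => by
    simpa [code, Fin.val_inj] using h
  have hcode0 (c : Λ) : 0 ≤ code c := Int.natCast_nonneg _
  have hcodem (c : Λ) : code c < m := by
    simp [code]
  have hdec (z : ℤ) : ∃ c, code c = z % m := by
    have h0 := Int.emod_nonneg z hm'
    have h1 := Int.emod_lt_of_pos z (Int.natCast_pos.2 hm)
    refine ⟨e.symm ⟨(z % m).toNat, by omega⟩, ?_⟩
    simp [code, h0]
  choose dec hdec using hdec
  have hdecode (c : Λ) (u : ℤ) : dec (code c + m * u) = c := by
    refine hcode ?_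
    rw [hdec, Int.add_mul_emod_self_left, Int.emod_eq_of_lt (hcode0 c) (hcodem c)]
  have hdiv (c : Λ) (u : ℤ) : (code c + m * u) / m = u := by
    rw [Int.add_mul_ediv_left _ _ hm', Int.ediv_eq_zero_of_lt (hcode0 c) (hcodem c), zero_add]
  let affine (c₁ c : Λ) (m x y : ℤ) (P : Option κ → ℤ) : Option κ → ℤ
    | none => code c₁ + m * P none
    | some k => if k = stack c then x + y * P (some k) else P (some k)
  let pt (c₁ c : Λ) (x : ℤ) : Option κ → ℤ
    | none => code c₁
    | some k => if k = stack c then x else 0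
  let scale (c : Λ) (y : ℤ) : Option κ → ℤ
    | none => m
    | some k => if k = stack c then y else 1
  have hscale (c : Λ) {y : ℤ} (hy : y ≠ 0) (k) : scale c y k ≠ 0 := by
    rcases k with _ | k <;> simp only [scale]
    · exact hm'
    · split_ifs <;> simp [hy]
  let rule (P : Option κ → ℤ) : Λ × Fin 5 :=
    (dec (P none), ⟨(P (some (stack (dec (P none)))) % 5).toNat, by omega⟩)
  let quo (P : Option κ → ℤ) : Option κ → ℤ
    | none => P none / m
    | some k => if k = stack (dec (P none)) then P (some k) / 5 else P (some k)
  let p (r : Λ × Fin 5) : Option κ → ℤ := pt r.1 r.1 (r.2 : ℕ)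
  let D (r : Λ × Fin 5) : Option κ → ℤ := scale r.1 5
  let q (r : Λ × Fin 5) : Option κ → ℤ := pt (next r.1 (r.2 : ℕ)) r.1 (a r.1 (r.2 : ℕ))
  let D' (r : Λ × Fin 5) : Option κ → ℤ := scale r.1 (b r.1 (r.2 : ℕ))
  have hrule (P) : p (rule P) + D (rule P) * quo P = P := by
    ext k
    rcases k with _ | k
    · simp only [p, D, pt, scale, rule, quo, Pi.add_apply, Pi.mul_apply, hdec]
      exact Int.emod_add_mul_ediv _ _
    · simp only [p, D, pt, scale, rule, quo, Pi.add_apply, Pi.mul_apply]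
      split_ifs with h
      · subst h
        have := Int.emod_nonneg (P (some (stack (dec (P none))))) (b := 5) (by norm_num)
        rw [Int.toNat_of_nonneg this]
        exact Int.emod_add_mul_ediv _ _
      · simp
  have hrule' (r u) : rule (p r + D r * u) = r := by
    have h : dec ((p r + D r * u) none) = r.1 := hdecode r.1 (u none)
    refine Prod.ext h (Fin.ext ?_)
    simp only [rule, h]
    simp only [p, D, pt, scale, Pi.add_apply, Pi.mul_apply, if_true]
    have := r.2.isLt
    omega
  have hquo (r u) : quo (p r + D r * u) = u := by
    have h : dec ((p r + D r * u) none) = r.1 := hdecode r.1 (u none)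
    ext k
    rcases k with _ | k
    · exact hdiv r.1 (u none)
    · simp only [quo, h]
      simp only [p, D, pt, scale, Pi.add_apply, Pi.mul_apply]
      split_ifs with hk
      · have := r.2.isLt
        omega
      · simp
  let F (P : Option κ → ℤ) : Option κ → ℤ := q (rule P) + D' (rule P) * quo P
  have hF (r u) : F (p r + D r * u) = q r + D' r * u := by simp only [F, hrule', hquo]
  let enc (s : Λ × (κ → ℤ)) : Option κ → ℤ
    | none => code s.1
    | some k => s.2 k
  have henc : Function.Injective enc := fun s s' h =>
    Prod.ext (hcode (congrFun h none)) (funext fun k => congrFun h (some k))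
  have hstep : Function.Semiconj enc (affineStep stack next a b) F := fun s => by
    have h : dec (enc s none) = s.1 := by simpa using hdecode s.1 0
    have hd : (((s.2 (stack s.1) % 5).toNat : ℕ) : ℤ) = s.2 (stack s.1) % 5 :=
      Int.toNat_of_nonneg (Int.emod_nonneg _ (by norm_num))
    ext k
    rcases k with _ | k
    · simp only [F, q, D', pt, scale, rule, quo, Pi.add_apply, Pi.mul_apply, h]
      simp only [enc, hd, affineStep]
      rw [show code s.1 / m = 0 by simpa using hdiv s.1 0, mul_zero, add_zero]
    · simp only [F, q, D', pt, scale, rule, quo, Pi.add_apply, Pi.mul_apply, h]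
      simp only [enc, hd, affineStep, Function.update_apply]
      split_ifs with hk
      · rw [hk]
      · simp
  have hFT : F (enc T) = enc T := by rw [← hstep T, hT]
  let C : Set (Option κ → ℤ) := {P | ∃ j, F^[j] P = enc T}
  have hCF (P) : P ∈ C ↔ F P ∈ C := by
    constructor
    · rintro ⟨j, hj⟩
      exact ⟨j, by rw [← Function.iterate_succ_apply, Function.iterate_succ_apply', hj, hFT]⟩
    · rintro ⟨j, hj⟩
      exact ⟨j + 1, hj⟩
  let pn (n : ℕ) : Option κ → ℕ
    | none => e c₀
    | some k => stk n k
  have hpn (n) : (fun i => (pn n i : ℤ)) = enc (c₀, fun i => stk n i) := by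
    ext k
    rcases k with _ | k <;> rfl
  refine exists_profinite_sequence_of_affine_system (p := p) (D := D) (q := q) (D' := D')
    (T := enc T) (C := C) (enc := pn) (fun r => hscale _ (by norm_num))
    (fun r => hscale _ (hb _ _)) ⟨0, rfl⟩ (fun r u => ?_) ?_ ?_ ?_
  · rw [hCF, hF]
  · rintro G hG hGF P ⟨j, hj⟩
    induction j generalizing P with
    | zero => rwa [show P = enc T from hj]
    | succ j ih =>
      have := ih hj
      rw [← hrule P, hF] at this
      rw [← hrule P]
      exact (hGF _ _).2 this
  · rintro (_ | i)
    · exact Computable.const _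
    · exact hstk i
  · rintro ⟨f, hf, h⟩
    refine hund ⟨f, hf, fun n => ?_⟩
    rw [h n, hpn]
    refine exists_congr fun j => ?_
    rw [← (hstep.iterate_right j) _, henc.eq_iff]

/-- A version for machines with infinitely many control states, finitely many of which are
accessible. -/
theorem exists_profinite_sequence_of_supported_stack_machine [Fintype κ] (stack : Λ → κ)
    (next : Λ → ℤ → Λ) (a b : Λ → ℤ → ℤ) (hb : ∀ c d, b c d ≠ 0) {A : Set Λ} (hA : A.Finite)
    (hnext : ∀ c ∈ A, ∀ d, next c d ∈ A) {T : Λ × (κ → ℤ)} (hTA : T.1 ∈ A)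
    (hT : affineStep stack next a b T = T) {c₀ : Λ} (hc₀ : c₀ ∈ A) {stk : ℕ → κ → ℕ}
    (hstk : ∀ i, Computable fun n => stk n i)
    (hund : ¬ ∃ f : ℕ → Bool, Computable f ∧ ∀ n, f n = true ↔
      ∃ j, (affineStep stack next a b)^[j] (c₀, fun i => stk n i) = T) :
    ∃ (k cR cS : ℕ) (R S : ℕ → List (List (Fin k × Bool))),
      Computable R ∧ Computable S ∧
      (∀ n, (R n).toFinset.card = cR) ∧ (∀ n, (S n).toFinset.card = cS) ∧
      (∀ n, ResiduallyFinite (wordPresentedGroup k (R n))) ∧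
      (∀ n, FinitelyPresentedGroup ↥(wordSubgroup k (R n) (S n))) ∧
      ¬ ∃ f : ℕ → Bool, Computable f ∧
          ∀ n, f n = true ↔
            (ProfiniteSurj (wordSubgroup k (R n) (S n)) ∧
              ProfiniteInj (wordSubgroup k (R n) (S n))) := by
  have := hA.to_subtype
  let val (s : A × (κ → ℤ)) : Λ × (κ → ℤ) := (s.1, s.2)
  have hval : Function.Injective val := fun s s' h => by
    simp only [val, Prod.mk.injEq] at h
    exact Prod.ext (Subtype.ext h.1) h.2
  have hstep : Function.Semiconj val (affineStep (fun c : A => stack c)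
    (fun c d => ⟨next c d, hnext c c.2 d⟩) (fun c => a c) (fun c => b c))
    (affineStep stack next a b) := fun s => rfl
  refine exists_profinite_sequence_of_stack_machine (fun c : A => stack c)
    (fun c d => ⟨next c d, hnext c c.2 d⟩) (fun c => a c) (fun c => b c) (fun c => hb c)
    (T := (⟨T.1, hTA⟩, T.2)) (hval ?_) ⟨c₀, hc₀⟩ hstk ?_
  · rw [hstep]
    exact hT
  · rintro ⟨f, hf, h⟩
    refine hund ⟨f, hf, fun n => ?_⟩
    rw [h n]
    refine exists_congr fun j => ?_
    rw [← hval.eq_iff, hstep.iterate_right j]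

end StackMachine

section StackSimulation

open Turing Turing.TM2

variable {κ G Λ σ : Type} [DecidableEq κ]

/-- The integer of a stack in base five. -/
def stackValue (dg : G → ℕ) : List G → ℕ
  | [] => 0
  | g :: l => dg g + 5 * stackValue dg l

/-- The stack examined by a statement. -/
def stmtStack (k₀ : κ) : Stmt (fun _ : κ => G) Λ σ × σ → κ
  | (.push k _ _, _) => k
  | (.peek k _ _, _) => k
  | (.pop k _ _, _) => k
  | _ => k₀

/-- The statement executed after a given one. -/
def stmtNext (M : Λ → Stmt (fun _ : κ => G) Λ σ) (ung : ℤ → Option G) :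
    Stmt (fun _ : κ => G) Λ σ × σ → ℤ → Stmt (fun _ : κ => G) Λ σ × σ
  | (.push _ _ q, v), _ => (q, v)
  | (.peek _ f q, v), d => (q, f v (ung d))
  | (.pop _ f q, v), d => (q, f v (ung d))
  | (.load f q, v), _ => (q, f v)
  | (.branch f q₁ q₂, v), _ => (bif f v then q₁ else q₂, v)
  | (.goto l, v), _ => (M (l v), v)
  | (.halt, v), _ => (.halt, v)

/-- The constant term of the action of a statement on a stack. -/
def stmtOffset (dg : G → ℕ) : Stmt (fun _ : κ => G) Λ σ × σ → ℤ → ℤ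
  | (.push _ f _, v), d => dg (f v) + 5 * d
  | (.pop _ _ _, _), _ => 0
  | _, d => d

/-- The linear coefficient of the action of a statement on a stack. -/
def stmtScale : Stmt (fun _ : κ => G) Λ σ × σ → ℤ → ℤ
  | (.push _ _ _, _), _ => 25
  | (.pop _ _ _, _), _ => 1
  | _, _ => 5

/-- The small step semantics of a stack machine on integers. -/
def stmtStep (M : Λ → Stmt (fun _ : κ => G) Λ σ) (dg : G → ℕ) (ung : ℤ → Option G) (k₀ : κ) :
    (Stmt (fun _ : κ => G) Λ σ × σ) × (κ → ℤ) → (Stmt (fun _ : κ => G) Λ σ × σ) × (κ → ℤ) :=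
  affineStep (stmtStack k₀) (stmtNext M ung) (stmtOffset dg) stmtScale

/-- The configuration of the small step semantics attached to a configuration. -/
def cfgState (M : Λ → Stmt (fun _ : κ => G) Λ σ) (dg : G → ℕ) (c : Cfg (fun _ : κ => G) Λ σ) :
    (Stmt (fun _ : κ => G) Λ σ × σ) × (κ → ℤ) :=
  ((c.l.elim .halt M, c.var), fun k => stackValue dg (c.stk k))

variable (M : Λ → Stmt (fun _ : κ => G) Λ σ) {dg : G → ℕ} {ung : ℤ → Option G} (k₀ : κ)

theorem stackValue_emod (hdg : ∀ g, dg g < 5) (h₀ : ung 0 = none) (h : ∀ g, ung (dg g) = some g)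
    (l : List G) : ung ((stackValue dg l : ℤ) % 5) = l.head? := by
  rcases l with _ | ⟨g, l⟩
  · simpa [stackValue] using h₀
  · have : ((stackValue dg (g :: l) : ℕ) : ℤ) % 5 = dg g := by
      have := hdg g
      simp only [stackValue]
      omega
    rw [this, h]
    rfl

theorem stackValue_ediv (hdg : ∀ g, dg g < 5) (l : List G) :
    (stackValue dg l : ℤ) / 5 = stackValue dg l.tail := by
  rcases l with _ | ⟨g, l⟩
  · simp [stackValue]
  · have := hdg g
    simp only [stackValue, List.tail_cons]
    omega

theorem update_stackValue (S : κ → List G) (k : κ) (l : List G) {z : ℤ}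
    (hz : z = stackValue dg l) : Function.update (fun k => (stackValue dg (S k) : ℤ)) k z =
      fun k' => (stackValue dg (Function.update S k l k') : ℤ) := by
  subst hz
  ext k'
  by_cases hk : k' = k
  · subst hk; simp
  · simp [hk]

theorem stackValue_add_ediv (l : List G) :
    (stackValue dg l : ℤ) % 5 + 5 * ((stackValue dg l : ℤ) / 5) = stackValue dg l :=
  Int.emod_add_mul_ediv _ _

section Steps

variable (hdg : ∀ g, dg g < 5) (h₀ : ung 0 = none) (h : ∀ g, ung (dg g) = some g)
  (v : σ) (S : κ → List G)

theorem stmtStep_push (k : κ) (f : σ → G) (q) :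
    stmtStep M dg ung k₀ ((.push k f q, v), fun k => stackValue dg (S k)) =
      ((q, v), fun k' => (stackValue dg (Function.update S k (f v :: S k) k') : ℤ)) := by
  refine Prod.ext rfl (update_stackValue S k _ ?_)
  simp only [stackValue, stmtStack, stmtOffset, stmtScale]
  have := stackValue_add_ediv (dg := dg) (S k)
  push_cast
  linarith

include hdg h₀ h in
theorem stmtStep_pop (k : κ) (f : σ → Option G → σ) (q) :
    stmtStep M dg ung k₀ ((.pop k f q, v), fun k => stackValue dg (S k)) =
      ((q, f v (S k).head?),
        fun k' => (stackValue dg (Function.update S k (S k).tail k') : ℤ)) := by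
  refine Prod.ext ?_ (update_stackValue S k _ ?_)
  · simp [stmtStep, affineStep, stmtNext, stmtStack, stackValue_emod hdg h₀ h]
  · simp [stmtStack, stmtOffset, stmtScale, stackValue_ediv hdg]

theorem stmtStep_of_keep (q : Stmt (fun _ : κ => G) Λ σ)
    (ho : stmtOffset dg (q, v) = fun d => d) (hs : stmtScale (q, v) = fun _ => 5) :
    stmtStep M dg ung k₀ ((q, v), fun k => stackValue dg (S k)) =
      (stmtNext M ung (q, v) ((stackValue dg (S (stmtStack k₀ (q, v))) : ℤ) % 5),
        fun k => (stackValue dg (S k) : ℤ)) := by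
  refine Prod.ext rfl ?_
  simp only [stmtStep, affineStep, ho, hs, stackValue_add_ediv]
  exact Function.update_eq_self _ (fun k => (stackValue dg (S k) : ℤ))

include hdg h₀ h in
theorem stmtStep_peek (k : κ) (f : σ → Option G → σ) (q) :
    stmtStep M dg ung k₀ ((.peek k f q, v), fun k => stackValue dg (S k)) =
      ((q, f v (S k).head?), fun k' => (stackValue dg (S k') : ℤ)) := by
  rw [stmtStep_of_keep M k₀ v S _ rfl rfl]
  simp [stmtNext, stmtStack, stackValue_emod hdg h₀ h]

end Steps

theorem exists_iterate_stmtStep (hdg : ∀ g, dg g < 5) (h₀ : ung 0 = none)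
    (h : ∀ g, ung (dg g) = some g) (q : Stmt (fun _ : κ => G) Λ σ) (v : σ) (S : κ → List G) :
    ∃ j, (stmtStep M dg ung k₀)^[j] ((q, v), fun k => stackValue dg (S k)) =
      cfgState M dg (stepAux q v S) := by
  induction q generalizing v S with
  | push k f q ih =>
    obtain ⟨j, hj⟩ := ih v (Function.update S k (f v :: S k))
    exact ⟨j + 1, by rw [Function.iterate_succ_apply, stmtStep_push, hj]; rfl⟩
  | peek k f q ih =>
    obtain ⟨j, hj⟩ := ih (f v (S k).head?) S
    exact ⟨j + 1, by rw [Function.iterate_succ_apply, stmtStep_peek M k₀ hdg h₀ h, hj]; rfl⟩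
  | pop k f q ih =>
    obtain ⟨j, hj⟩ := ih (f v (S k).head?) (Function.update S k (S k).tail)
    exact ⟨j + 1, by rw [Function.iterate_succ_apply, stmtStep_pop M k₀ hdg h₀ h, hj]; rfl⟩
  | load f q ih =>
    obtain ⟨j, hj⟩ := ih (f v) S
    exact ⟨j + 1, by
      rw [Function.iterate_succ_apply, stmtStep_of_keep M k₀ v S _ rfl rfl]; exact hj⟩
  | branch f q₁ q₂ ih₁ ih₂ =>
    have : ∃ j, (stmtStep M dg ung k₀)^[j] ((bif f v then q₁ else q₂, v),
        fun k => stackValue dg (S k)) = cfgState M dg (stepAux (.branch f q₁ q₂) v S) := by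
      rw [stepAux]
      cases f v
      · exact ih₂ v S
      · exact ih₁ v S
    obtain ⟨j, hj⟩ := this
    exact ⟨j + 1, by
      rw [Function.iterate_succ_apply, stmtStep_of_keep M k₀ v S _ rfl rfl]; exact hj⟩
  | goto l => exact ⟨1, stmtStep_of_keep M k₀ v S _ rfl rfl⟩
  | halt => exact ⟨0, rfl⟩

theorem eval_dom_of_iterate_stmtStep (hdg : ∀ g, dg g < 5) (h₀ : ung 0 = none)
    (h : ∀ g, ung (dg g) = some g) (j : ℕ) (q : Stmt (fun _ : κ => G) Λ σ) (v : σ)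
    (S : κ → List G)
    (hj : ((stmtStep M dg ung k₀)^[j] ((q, v), fun k => stackValue dg (S k))).1.1 = .halt) :
    (StateTransition.eval (step M) (stepAux q v S)).Dom := by
  induction j generalizing q v S with
  | zero =>
    obtain rfl : q = .halt := hj
    exact Part.dom_iff_mem.2 ⟨_, StateTransition.mem_eval.2 ⟨.refl, rfl⟩⟩
  | succ j ih =>
    rw [Function.iterate_succ_apply] at hj
    cases q with
    | push k f q =>
      rw [stmtStep_push] at hj
      exact ih q v (Function.update S k (f v :: S k)) hj
    | peek k f q =>
      rw [stmtStep_peek M k₀ hdg h₀ h] at hj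
      exact ih q (f v (S k).head?) S hj
    | pop k f q =>
      rw [stmtStep_pop M k₀ hdg h₀ h] at hj
      exact ih q (f v (S k).head?) (Function.update S k (S k).tail) hj
    | load f q =>
      rw [stmtStep_of_keep M k₀ v S _ rfl rfl] at hj
      exact ih q (f v) S hj
    | branch f q₁ q₂ =>
      rw [stmtStep_of_keep M k₀ v S _ rfl rfl] at hj
      have := ih _ _ _ hj
      rw [stepAux]
      revert this
      cases f v <;> exact id
    | goto l =>
      rw [stmtStep_of_keep M k₀ v S _ rfl rfl] at hj
      have : (StateTransition.eval (step M) (stepAux (M (l v)) v S)).Dom := ih _ _ _ hj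
      rwa [stepAux, StateTransition.reaches_eval (f := step M) (b := stepAux (M (l v)) v S)
        (.single rfl)]
    | halt => exact Part.dom_iff_mem.2 ⟨_, StateTransition.mem_eval.2 ⟨.refl, rfl⟩⟩

theorem exists_iterate_of_reaches (hdg : ∀ g, dg g < 5) (h₀ : ung 0 = none)
    (h : ∀ g, ung (dg g) = some g) {c c' : Cfg (fun _ : κ => G) Λ σ}
    (hc : StateTransition.Reaches (step M) c c') :
    ∃ j, (stmtStep M dg ung k₀)^[j] (cfgState M dg c) = cfgState M dg c' := by
  induction hc with
  | refl => exact ⟨0, rfl⟩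
  | @tail c₁ c₂ _ h₁₂ ih =>
    obtain ⟨j, hj⟩ := ih
    obtain ⟨_ | l, v, S⟩ := c₁
    · simp at h₁₂
    · obtain rfl : stepAux (M l) v S = c₂ := by simpa using h₁₂
      obtain ⟨j', hj'⟩ := exists_iterate_stmtStep M k₀ hdg h₀ h (M l) v S
      exact ⟨j' + j, by rw [Function.iterate_add_apply, hj]; exact hj'⟩

/-- An undecidable halting problem for a finitely supported stack machine with a unique halting
configuration gives a sequence of subgroups of residually finite groups with an undecidable
profinite isomorphism problem. -/
theorem exists_profinite_sequence_of_TM2 (k₀ : κ) [Fintype κ] [Inhabited Λ] [Finite σ] {B : Finset Λ}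
    (hB : Supports M B) (hdg : ∀ g, dg g < 5) (h₀ : ung 0 = none) (h : ∀ g, ung (dg g) = some g)
    (v₀ v₁ : σ) (S₀ : ℕ → κ → List G) (S₁ : κ → List G)
    (hS₀ : ∀ k, Computable fun n => stackValue dg (S₀ n k))
    (hend : ∀ n c, c ∈ StateTransition.eval (step M) ⟨some default, v₀, S₀ n⟩ → c = ⟨none, v₁, S₁⟩)
    (hund : ¬ ∃ f : ℕ → Bool, Computable f ∧
      ∀ n, f n = true ↔ (StateTransition.eval (step M) ⟨some default, v₀, S₀ n⟩).Dom) :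
    ∃ (k cR cS : ℕ) (R S : ℕ → List (List (Fin k × Bool))),
      Computable R ∧ Computable S ∧
      (∀ n, (R n).toFinset.card = cR) ∧ (∀ n, (S n).toFinset.card = cS) ∧
      (∀ n, ResiduallyFinite (wordPresentedGroup k (R n))) ∧
      (∀ n, FinitelyPresentedGroup ↥(wordSubgroup k (R n) (S n))) ∧
      ¬ ∃ f : ℕ → Bool, Computable f ∧
          ∀ n, f n = true ↔
            (ProfiniteSurj (wordSubgroup k (R n) (S n)) ∧
              ProfiniteInj (wordSubgroup k (R n) (S n))) := by
  let A : Set (Stmt (fun _ : κ => G) Λ σ × σ) := {c | c.1 = .halt ∨ some c.1 ∈ stmts M B}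
  have hmem {l : Λ} (hl : l ∈ B) : some (M l) ∈ stmts M B := by
    simp only [stmts, Finset.mem_insertNone, Finset.mem_biUnion, Option.mem_def,
      Option.some.injEq, forall_eq']
    exact ⟨l, hl, stmts₁_self⟩
  have hA : A.Finite := by
    have hfin : {q : Stmt (fun _ : κ => G) Λ σ | q = .halt ∨ some q ∈ stmts M B}.Finite :=
      (Set.finite_singleton _).union ((stmts M B).finite_toSet.preimage
        (Option.some_injective _).injOn)
    exact (hfin.prod Set.finite_univ).subset fun c hc => ⟨hc, trivial⟩
  have hnext : ∀ c ∈ A, ∀ d, stmtNext M ung c d ∈ A := by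
    rintro ⟨q, v⟩ (hc | hc) d
    · obtain rfl : q = .halt := hc
      exact .inl rfl
    · have hsub {q'} (hq : q' ∈ stmts₁ q) : some q' ∈ stmts M B := stmts_trans hq hc
      right
      cases q with
      | push k f q => exact hsub (q' := q) (by simp [stmts₁, stmts₁_self])
      | peek k f q => exact hsub (q' := q) (by simp [stmts₁, stmts₁_self])
      | pop k f q => exact hsub (q' := q) (by simp [stmts₁, stmts₁_self])
      | load f q => exact hsub (q' := q) (by simp [stmts₁, stmts₁_self])
      | branch f q₁ q₂ =>
        simp only [stmtNext]
        cases f v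
        · exact hsub (by simp [stmts₁, stmts₁_self])
        · exact hsub (by simp [stmts₁, stmts₁_self])
      | goto l => exact hmem (stmts_supportsStmt hB hc v)
      | halt => exact hc
  refine exists_profinite_sequence_of_supported_stack_machine (stmtStack k₀) (stmtNext M ung)
    (stmtOffset dg) stmtScale ?_ hA hnext (T := cfgState M dg ⟨none, v₁, S₁⟩) (.inl rfl)
    (stmtStep_of_keep M k₀ v₁ S₁ _ rfl rfl) (c₀ := (M default, v₀)) (.inr (hmem hB.1)) hS₀ ?_
  · rintro ⟨q, v⟩ d
    cases q <;> simp [stmtScale]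
  · rintro ⟨f, hf, hfn⟩
    refine hund ⟨f, hf, fun n => (hfn n).trans ⟨?_, fun hn => ?_⟩⟩
    · rintro ⟨j, hj⟩
      have := eval_dom_of_iterate_stmtStep M k₀ hdg h₀ h j (M default) v₀ (S₀ n)
        (by rw [stmtStep, hj]; rfl)
      rwa [StateTransition.reaches_eval (f := step M) (b := stepAux (M default) v₀ (S₀ n))
        (.single rfl)]
    · obtain ⟨c, hc⟩ := Part.dom_iff_mem.1 hn
      obtain rfl := hend n c hc
      exact exists_iterate_of_reaches M k₀ hdg h₀ h (StateTransition.mem_eval.1 hc).1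

end StackSimulation

section UniversalMachine

open Turing Turing.PartrecToTM2

/-- The base five digit of a symbol of the stack alphabet. -/
def symbolDigit : Γ' → ℕ
  | .cons => 1
  | .consₗ => 2
  | .bit0 => 3
  | .bit1 => 4

/-- The symbol of the stack alphabet with a given base five digit. -/
def digitSymbol (d : ℤ) : Option Γ' :=
  if d = 1 then some .cons else if d = 2 then some .consₗ else
    if d = 3 then some .bit0 else if d = 4 then some .bit1 else none

theorem trNat_of_ne_zero {n : ℕ} (hn : n ≠ 0) :
    trNat n = (bif n.bodd then Γ'.bit1 else Γ'.bit0) :: trNat n.div2 := by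
  conv_lhs => rw [← Nat.bit_bodd_div2 n]
  have hbit : (n.bodd = false → n.div2 ≠ 0) := by
    intro h h'
    exact hn (by rw [← Nat.bit_bodd_div2 n, h, h']; rfl)
  rw [trNat, trNat, ← Num.ofNat'_eq, Num.ofNat'_bit, Num.ofNat'_eq]
  revert hbit
  generalize n.bodd = b
  generalize n.div2 = m
  intro hbit
  cases b
  · have hm : (m : Num) ≠ 0 := by exact_mod_cast hbit rfl
    cases h : (m : Num) with
    | zero => exact absurd h hm
    | pos p => rfl
  · cases (m : Num) <;> rfl

theorem primrec_stackValue_trNat :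
    Primrec fun n => stackValue symbolDigit (trNat n ++ [Γ'.cons]) := by
  set F := fun n => stackValue symbolDigit (trNat n ++ [Γ'.cons]) with hF
  have h₂ : Primrec₂ fun (_ : Unit) n => F n := by
    refine Primrec.nat_strong_rec _ (g := fun _ l => if l.length = 0 then some 1 else
      (l[l.length / 2]?).map fun r => (bif l.length.bodd then 4 else 3) + 5 * r) ?_ ?_
    · have hlen : Primrec fun p : Unit × List ℕ => p.2.length :=
        Primrec.list_length.comp Primrec.snd
      refine Primrec.ite (Primrec.eq.comp hlen (Primrec.const 0)) (Primrec.const _) ?_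
      refine Primrec.option_map (Primrec.list_getElem?.comp Primrec.snd
        (Primrec.nat_div.comp hlen (Primrec.const 2))) ?_
      exact Primrec.nat_add.comp
        (Primrec.cond (Primrec.nat_bodd.comp (hlen.comp Primrec.fst)) (Primrec.const 4)
          (Primrec.const 3))
        (Primrec.nat_mul.comp (Primrec.const 5) Primrec.snd)
    · intro _ n
      rcases eq_or_ne n 0 with rfl | hn
      · simp [hF, stackValue, symbolDigit]
      · have hlt : n / 2 < n := Nat.div_lt_self (Nat.pos_of_ne_zero hn) one_lt_two
        simp only [List.length_map, List.length_range, hn, if_false, List.getElem?_map,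
          List.getElem?_range hlt, Option.map_some, Option.some.injEq]
        simp only [hF]
        rw [trNat_of_ne_zero hn, Nat.div2_val]
        cases n.bodd <;> rfl
  exact h₂.comp (Primrec.const ()) Primrec.id

theorem exists_code_undecidable_dom : ∃ c : ToPartrec.Code,
    (∀ n, ∀ w ∈ c.eval [n], w = [0]) ∧
      ¬ ∃ f : ℕ → Bool, Computable f ∧ ∀ n, f n = true ↔ (c.eval [n]).Dom := by
  have hg : Partrec fun m : ℕ =>
      (Nat.Partrec.Code.eval (Denumerable.ofNat Nat.Partrec.Code m) 0).map fun _ => 0 :=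
    (Nat.Partrec.Code.eval_part.comp (Computable.ofNat _) (Computable.const 0)).map
      (Computable.const 0).to₂
  obtain ⟨c, hc⟩ := ToPartrec.Code.exists_code (Nat.Partrec'.part_iff₁.2 hg)
  have hc' (n : ℕ) : c.eval [n] = ((Nat.Partrec.Code.eval
      (Denumerable.ofNat Nat.Partrec.Code n) 0).map fun _ => 0).map fun x => [x] :=
    hc (n ::ᵥ .nil)
  refine ⟨c, fun n w hw => ?_, ?_⟩
  · rw [hc', Part.mem_map_iff] at hw
    obtain ⟨x, hx, rfl⟩ := hw
    obtain ⟨y, -, rfl⟩ := (Part.mem_map_iff _).1 hx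
    rfl
  · rintro ⟨f, hf, hfn⟩
    refine ComputablePred.halting_problem 0 (ComputablePred.computable_iff.2
      ⟨fun e => f (Encodable.encode e), hf.comp Computable.encode, funext fun e => propext ?_⟩)
    rw [hfn, hc', Denumerable.ofNat_encode]
    rfl

end UniversalMachine

/-- **Theorem B.** There are computable sequences `R_n`, `S_n` of finite sets of words in
`k` generators, of constant cardinalities, such that each `Γ_n = ⟨x₁,…,x_k ∣ R_n⟩` is
residually finite, the subgroup `P_n ≤ Γ_n` generated by the images of `S_n` is finitely
presentable, and no algorithm decides for which `n` the inclusion `P_n ↪ Γ_n` induces an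
isomorphism of profinite completions. -/
theorem exists_undecidable_profinite_iso_sequence :
    ∃ (k cR cS : ℕ) (R S : ℕ → List (List (Fin k × Bool))),
      Computable R ∧ Computable S ∧
      (∀ n, (R n).toFinset.card = cR) ∧ (∀ n, (S n).toFinset.card = cS) ∧
      (∀ n, ResiduallyFinite (wordPresentedGroup k (R n))) ∧
      (∀ n, FinitelyPresentedGroup ↥(wordSubgroup k (R n) (S n))) ∧
      ¬ ∃ f : ℕ → Bool, Computable f ∧
          ∀ n, f n = true ↔
            (ProfiniteSurj (wordSubgroup k (R n) (S n)) ∧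
              ProfiniteInj (wordSubgroup k (R n) (S n))) := by
  obtain ⟨c, hc, hund⟩ := exists_code_undecidable_dom
  let : Fintype Turing.PartrecToTM2.K' :=
    ⟨{.main, .rev, .aux, .stack}, by intro x; cases x <;> simp⟩
  let : Inhabited Turing.PartrecToTM2.Λ' :=
    ⟨Turing.PartrecToTM2.trNormal c Turing.PartrecToTM2.Cont'.halt⟩
  have heval (n : ℕ) := Turing.PartrecToTM2.tr_eval c [n]
  refine exists_profinite_sequence_of_TM2 (dg := symbolDigit) (ung := digitSymbol)
    Turing.PartrecToTM2.tr .main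
    (Turing.PartrecToTM2.tr_supports c Turing.PartrecToTM2.Cont'.halt)
    (fun g => by cases g <;> simp [symbolDigit]) rfl (fun g => by cases g <;> rfl)
    none none (fun n => Turing.PartrecToTM2.K'.elim (Turing.PartrecToTM2.trList [n]) [] [] [])
    (Turing.PartrecToTM2.K'.elim (Turing.PartrecToTM2.trList [0]) [] [] []) ?_ ?_ ?_
  · intro k
    cases k
    · exact primrec_stackValue_trNat.to_comp
    all_goals exact Computable.const 0
  · intro n d hd
    have hd' : d ∈ Turing.PartrecToTM2.halt <$> c.eval [n] := heval n ▸ hd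
    obtain ⟨w, hw, rfl⟩ := (Part.mem_map_iff _).1 hd'
    rw [hc n w hw]
    rfl
  · rintro ⟨f, hf, hfn⟩
    refine hund ⟨f, hf, fun n => (hfn n).trans ?_⟩
    exact iff_of_eq (congrArg Part.Dom (heval n))
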